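/- Let q be a power of a prime and F_q the finite field with q elements. Let A ⊆ F_q with |A| ≥ 2, and suppose there is a constant C > 0 such that for every proper subfield G of F_q and all elements c, d ∈ F_q one has |A ∩ (cG + d)| ≤ C·max{|G|^{1/2}, |A|^{51/52}}. Then there is a constant C' > 0 depending only on C such that T(A) ≤ C'·(|A|^{5 - 1/104} + q^{-1/95}|A|^{5 + 1/95}). -/

import Mathlib

open scoped Classical Pointwise

noncomputable section

namespace STP

variable {F : Type} [Field F]

def collinearTriples (A B : Finset F) : ℕ :=
  (((A ×ˢ A ×ˢ A) ×ˢ (B ×ˢ B ×ˢ B)).filter fun x =>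
    (x.1.2.1 - x.1.1) * (x.2.2.2 - x.2.1) = (x.1.2.2 - x.1.1) * (x.2.2.1 - x.2.1)).card

def IsLine (l : Set (F × F)) : Prop :=
  ∃ a b c : F, (a, b) ≠ (0, 0) ∧ l = {p : F × F | a * p.1 + b * p.2 = c}

def incidences (P : Finset (F × F)) (L : Finset (Set (F × F))) : ℕ :=
  ((P ×ˢ L).filter fun x => x.1 ∈ x.2).card

def kIncidences (P : Finset (F × F)) (L : Finset (Set (F × F))) (k : ℕ) : ℕ :=
  (((Fintype.piFinset fun _ : Fin k => P) ×ˢ L).filter fun x => ∀ i, x.1 i ∈ x.2).card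

def numLines (P : Finset (F × F)) : ℕ :=
  Set.ncard {l : Set (F × F) | IsLine l ∧ 2 ≤ (P.filter (· ∈ l)).card}

def addEnergy (X Y : Finset F) : ℕ :=
  (((X ×ˢ X) ×ˢ (Y ×ˢ Y)).filter fun t => t.1.1 + t.2.1 = t.1.2 + t.2.2).card

def mulEnergy (A : Finset F) : ℕ :=
  (((A ×ˢ A) ×ˢ (A ×ˢ A)).filter fun t => t.1.1 * t.2.1 = t.1.2 * t.2.2).card

def quotSet (X : Finset F) : Set F :=
  {r : F | ∃ x1 ∈ X, ∃ x2 ∈ X, ∃ x3 ∈ X, ∃ x4 ∈ X, x3 ≠ x4 ∧ r = (x1 - x2) / (x3 - x4)}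

def subfieldCond (A : Finset F) (C bound : ℝ) : Prop :=
  ∀ G : Subfield F, G ≠ ⊤ → ∀ c d : F,
    ((A.filter fun x => ∃ g ∈ G, x = c * g + d).card : ℝ) ≤
      C * max ((Nat.card G : ℝ) ^ ((1:ℝ)/2)) bound

def linesOf [Fintype F] (P : Finset (F × F)) : Finset (Set (F × F)) :=
  Set.Finite.toFinset (Set.toFinite {l : Set (F × F) | IsLine l ∧ 2 ≤ (P.filter (· ∈ l)).card})

def tripleCount [Fintype F] (P : Finset (F × F)) : ℕ :=
  ∑ l ∈ linesOf P, ((P.filter (· ∈ l)).card) ^ 3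

/-- Dilate of a finite set. -/
def sc (r : F) (Z : Finset F) : Finset F := Z.image (fun z => r * z)

/-- Structured pair of sets together with a set of approximate multipliers. -/
structure Conf (β N : ℝ) (X Z B : Finset F) : Prop where
  b0 : 0 < β
  b1 : β ≤ 1
  n0 : 0 < N
  cZ : β * N ≤ (Z.card : ℝ)
  dX : β ^ 5 * ((X - X).card : ℝ) ≤ N
  dZ : β ^ 5 * ((Z - Z).card : ℝ) ≤ N
  mu : ∀ b ∈ B, b ≠ 0 ∧ ∃ t, β ^ 3 * N ≤ ((X.filter (fun y => b * y + t ∈ Z)).card : ℝ)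

lemma shrink (U V : Finset F) : ∃ t, U.card * V.card ≤
    (U - V).card * (U.filter (fun u => u - t ∈ V)).card := by
  by_cases hne : (U - V).Nonempty
  swap
  · refine ⟨0, ?_⟩
    rw [Finset.sub_nonempty, not_and_or, Finset.not_nonempty_iff_eq_empty,
      Finset.not_nonempty_iff_eq_empty] at hne
    rcases hne with h | h <;> simp [h]
  by_contra hcon
  push Not at hcon
  have h1 : (U ×ˢ V).card = ∑ t ∈ U - V, ((U ×ˢ V).filter (fun p => p.1 - p.2 = t)).card := by
    apply Finset.card_eq_sum_card_fiberwise
    intro p hp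
    have hp' := Finset.mem_product.1 (Finset.mem_coe.1 hp)
    exact Finset.mem_coe.2 (Finset.sub_mem_sub hp'.1 hp'.2)
  have h2 : ∀ t, ((U ×ˢ V).filter (fun p => p.1 - p.2 = t)).card ≤
      (U.filter (fun u => u - t ∈ V)).card := by
    intro t
    apply Finset.card_le_card_of_injOn (fun p => p.1)
    · intro p hp
      simp only [Finset.coe_filter, Finset.mem_product, Set.mem_ofPred_eq] at hp ⊢
      refine ⟨hp.1.1, ?_⟩
      rw [← hp.2]; simpa using hp.1.2
    · intro p hp p' hp' h
      simp only [Finset.coe_filter, Finset.mem_product, Set.mem_ofPred_eq] at hp hp'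
      have h' : p.1 = p'.1 := h
      ext
      · exact h'
      · have := hp.2.trans hp'.2.symm
        rw [h'] at this
        simpa using this
  rw [Finset.card_product] at h1
  obtain ⟨t0, ht0, hmax⟩ := Finset.exists_max_image (U - V)
    (fun t => (U.filter (fun u => u - t ∈ V)).card) hne
  have h3 : ∑ t ∈ U - V, ((U ×ˢ V).filter (fun p => p.1 - p.2 = t)).card ≤
      (U - V).card * (U.filter (fun u => u - t0 ∈ V)).card := by
    rw [← smul_eq_mul]
    apply Finset.sum_le_card_nsmul
    intro t ht
    exact (h2 t).trans (hmax t ht)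
  have := hcon t0
  omega

lemma shrinkR {β N : ℝ} (hβ : 0 < β) (hN : 0 < N) (W U V : Finset F) (hU : U ⊆ W) (hV : V ⊆ W)
    (hW : β ^ 5 * ((W - W).card : ℝ) ≤ N) (hVc : β ^ 3 * N ≤ (V.card : ℝ)) :
    ∃ t, β ^ 8 * (U.card : ℝ) ≤ ((U.filter (fun u => u - t ∈ V)).card : ℝ) := by
  obtain ⟨t, ht⟩ := shrink U V
  refine ⟨t, ?_⟩
  have h1 : (U - V).card ≤ (W - W).card := Finset.card_le_card (Finset.sub_subset_sub hU hV)
  have ht' : (U.card : ℝ) * V.card ≤ (U - V).card * ((U.filter (fun u => u - t ∈ V)).card : ℝ) := by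
    exact_mod_cast ht
  set c : ℝ := ((U.filter (fun u => u - t ∈ V)).card : ℝ)
  have hc : 0 ≤ c := by positivity
  have h1' : ((U - V).card : ℝ) ≤ (W - W).card := by exact_mod_cast h1
  have h2 : β ^ 8 * (U.card : ℝ) * N ≤ c * N := by
    calc β ^ 8 * (U.card : ℝ) * N = β ^ 5 * (U.card * (β ^ 3 * N)) := by ring
      _ ≤ β ^ 5 * (U.card * V.card) := by gcongr
      _ ≤ β ^ 5 * ((W - W).card * c) := by
          apply mul_le_mul_of_nonneg_left _ (by positivity)
          exact ht'.trans (mul_le_mul_of_nonneg_right h1' hc)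
      _ = (β ^ 5 * (W - W).card) * c := by ring
      _ ≤ N * c := by gcongr
      _ = c * N := by ring
  exact le_of_mul_le_mul_right h2 hN

lemma Conf.shrinkX {β N : ℝ} {X Z B : Finset F} (h : Conf β N X Z B) (U : Finset F) (hU : U ⊆ X)
    (b : F) (hb : b ∈ B) : ∃ U', U' ⊆ U ∧ β ^ 8 * (U.card : ℝ) ≤ (U'.card : ℝ) ∧
      ∃ t, ∀ u ∈ U', b * u + t ∈ Z := by
  obtain ⟨hb0, t, ht⟩ := h.mu b hb
  obtain ⟨s, hs⟩ := shrinkR h.b0 h.n0 X U _ hU (Finset.filter_subset _ _) h.dX ht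
  refine ⟨_, Finset.filter_subset _ _, hs, t - b * s, ?_⟩
  intro u hu
  have := (Finset.mem_filter.1 (Finset.mem_filter.1 hu).2).2
  convert this using 1
  ring

lemma Conf.shrinkZ {β N : ℝ} {X Z B : Finset F} (h : Conf β N X Z B) (U : Finset F) (hU : U ⊆ Z)
    (b c : F) (hb : b ∈ B) (hc : c ∈ B) : ∃ U', U' ⊆ U ∧ β ^ 16 * (U.card : ℝ) ≤ (U'.card : ℝ) ∧
      ∃ t, ∀ u ∈ U', c / b * u + t ∈ Z := by
  obtain ⟨hb0, t, ht⟩ := h.mu b hb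
  set Xb := X.filter (fun y => b * y + t ∈ Z) with hXb
  have hinj : Function.Injective (fun y : F => b * y + t) := by
    intro x y hxy
    simpa [hb0] using hxy
  have hVZ : Xb.image (fun y => b * y + t) ⊆ Z := by
    intro z hz
    obtain ⟨y, hy, rfl⟩ := Finset.mem_image.1 hz
    exact (Finset.mem_filter.1 hy).2
  obtain ⟨s, hs⟩ := shrinkR h.b0 h.n0 Z U (Xb.image (fun y => b * y + t)) hU hVZ h.dZ
    (by rw [Finset.card_image_of_injective _ hinj]; exact ht)
  set U1 := U.filter (fun u => u - s ∈ Xb.image (fun y => b * y + t)) with hU1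
  have hinj2 : Function.Injective (fun u : F => (u - s - t) / b) := by
    intro x y hxy
    have : (x - s - t) / b = (y - s - t) / b := hxy
    field_simp at this
    simpa using this
  have hU2 : U1.image (fun u => (u - s - t) / b) ⊆ X := by
    intro x hx
    obtain ⟨u, hu, rfl⟩ := Finset.mem_image.1 hx
    obtain ⟨y, hy, hyu⟩ := Finset.mem_image.1 (Finset.mem_filter.1 hu).2
    have : (u - s - t) / b = y := by
      rw [← hyu]; field_simp; ring
    rw [this]
    exact (Finset.mem_filter.1 hy).1
  obtain ⟨U3, hU3, hU3c, t3, ht3⟩ := h.shrinkX _ hU2 c hc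
  rw [Finset.card_image_of_injective _ hinj2] at hU3c
  refine ⟨U1.filter (fun u => (u - s - t) / b ∈ U3), 
    (Finset.filter_subset _ _).trans (Finset.filter_subset _ _), ?_, t3 - c * (s + t) / b, ?_⟩
  · have h5 : U3.card ≤ (U1.filter (fun u => (u - s - t) / b ∈ U3)).card := by
      refine le_trans (Finset.card_le_card ?_) (Finset.card_image_le
        (s := U1.filter (fun u => (u - s - t) / b ∈ U3)) (f := fun u => (u - s - t) / b))
      intro x hx
      obtain ⟨u, hu, rfl⟩ := Finset.mem_image.1 (hU3 hx)
      exact Finset.mem_image_of_mem _ (Finset.mem_filter.2 ⟨hu, hx⟩)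
    have h5' : (U3.card : ℝ) ≤ (U1.filter (fun u => (u - s - t) / b ∈ U3)).card := by
      exact_mod_cast h5
    have hb := h.b0
    calc β ^ 16 * (U.card : ℝ) = β ^ 8 * (β ^ 8 * U.card) := by ring
      _ ≤ β ^ 8 * U1.card := by gcongr
      _ ≤ U3.card := hU3c
      _ ≤ _ := h5'
  · intro u hu
    have := ht3 _ (Finset.mem_filter.1 hu).2
    convert this using 1
    field_simp
    ring

lemma Conf.plun {β N : ℝ} {X Z B : Finset F} (h : Conf β N X Z B) (k : ℕ) (hk : 1 ≤ k) :
    β ^ (12 * k - 1) * ((k • Z - k • Z).card : ℝ) ≤ N := by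
  have hb := h.b0
  have hn := h.n0
  have hZ : 0 < (Z.card : ℝ) := lt_of_lt_of_le (by positivity) h.cZ
  have hZn : Z.Nonempty := by
    rw [← Finset.card_pos]; exact_mod_cast hZ
  have h1 := Finset.pluennecke_ruzsa_inequality_nsmul_sub_nsmul_sub hZn Z k k
  have h2 : ((k • Z - k • Z).card : ℝ) ≤ ((Z - Z).card / Z.card : ℝ) ^ (k + k) * Z.card := by
    have h1' := (NNRat.cast_le (K := ℝ)).2 h1
    push_cast at h1'
    exact h1'
  obtain ⟨j, rfl⟩ : ∃ j, k = j + 1 := ⟨k - 1, by omega⟩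
  have h3 : ((Z - Z).card / Z.card : ℝ) ^ (j + 1 + (j + 1)) * Z.card =
      (Z - Z).card * (((Z - Z).card : ℝ) / Z.card) ^ (2 * j + 1) := by
    have : j + 1 + (j + 1) = (2 * j + 1) + 1 := by ring
    rw [this, pow_succ]
    field_simp
  rw [h3] at h2
  have h4 : β ^ 6 * (((Z - Z).card : ℝ) / Z.card) ≤ 1 := by
    rw [← mul_div_assoc, div_le_one hZ]
    calc β ^ 6 * ((Z - Z).card : ℝ) = β * (β ^ 5 * (Z - Z).card) := by ring
      _ ≤ β * N := by gcongr; exact h.dZ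
      _ ≤ Z.card := h.cZ
  have h5 : 12 * (j + 1) - 1 = 5 + 6 * (2 * j + 1) := by omega
  rw [h5]
  calc β ^ (5 + 6 * (2 * j + 1)) * (((j + 1) • Z - (j + 1) • Z).card : ℝ)
      ≤ β ^ (5 + 6 * (2 * j + 1)) * ((Z - Z).card * (((Z - Z).card : ℝ) / Z.card) ^ (2 * j + 1)) := by
        gcongr
    _ = (β ^ 5 * (Z - Z).card) * (β ^ 6 * (((Z - Z).card : ℝ) / Z.card)) ^ (2 * j + 1) := by
        rw [pow_add, pow_mul, mul_pow]; ring
    _ ≤ N * 1 := by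
        apply mul_le_mul h.dZ (pow_le_one₀ (by positivity) h4) (by positivity) hn.le
    _ = N := by ring

lemma ruzsa2 (Z Z1 Z2 : Finset F) (h1 : Z1 ⊆ Z) (h2 : Z2 ⊆ Z) (r : F) (hr : r ≠ 0) :
    (Z + sc r Z).card * (Z1.card * Z2.card) ≤ (Z - Z).card * (Z - Z).card * (Z1 + sc r Z2).card := by
  have e1 := Finset.ruzsa_triangle_inequality_add_sub_add Z Z1 (sc r Z)
  have e2 := Finset.ruzsa_triangle_inequality_add_sub_add (sc r Z) (sc r Z2) Z1
  have hinj : Function.Injective (fun z : F => r * z) := mul_right_injective₀ hr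
  have c2 : (sc r Z2).card = Z2.card := Finset.card_image_of_injective _ hinj
  have c3 : (sc r Z2 - sc r Z).card ≤ (Z - Z).card := by
    have : sc r Z2 - sc r Z ⊆ (Z - Z).image (fun z => r * z) := by
      intro x hx
      obtain ⟨a, ha, b, hb, rfl⟩ := Finset.mem_sub.1 hx
      obtain ⟨a', ha', rfl⟩ := Finset.mem_image.1 ha
      obtain ⟨b', hb', rfl⟩ := Finset.mem_image.1 hb
      exact Finset.mem_image.2 ⟨a' - b', Finset.sub_mem_sub (h2 ha') hb', by ring⟩
    exact (Finset.card_le_card this).trans Finset.card_image_le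
  have c4 : (Z1 - Z).card ≤ (Z - Z).card := Finset.card_le_card (Finset.sub_subset_sub h1 le_rfl)
  rw [c2] at e2
  calc (Z + sc r Z).card * (Z1.card * Z2.card) = (Z1.card * (Z + sc r Z).card) * Z2.card := by ring
    _ ≤ ((Z1 - Z).card * (Z1 + sc r Z).card) * Z2.card := Nat.mul_le_mul_right _ e1
    _ = (Z1 - Z).card * (Z2.card * (sc r Z + Z1).card) := by rw [add_comm Z1]; ring
    _ ≤ (Z1 - Z).card * ((sc r Z2 - sc r Z).card * (sc r Z2 + Z1).card) := Nat.mul_le_mul_left _ e2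
    _ ≤ (Z - Z).card * ((Z - Z).card * (sc r Z2 + Z1).card) := by gcongr
    _ = _ := by rw [add_comm (sc r Z2)]; ring

/-- Common part of the two growth bounds. -/
lemma Conf.grow {β N : ℝ} {X Z B : Finset F} (h : Conf β N X Z B) (X1 X2 : Finset F) (b t : F)
    (hb : b ≠ 0) (h1 : ∀ x ∈ X1, b * x + t ∈ Z) (h2 : ∀ x ∈ X2, b * x + t ∈ Z) (i j k : ℕ)
    (hk : 1 ≤ k)
    (c1 : β ^ i * N ≤ (X1.card : ℝ)) (c2 : β ^ j * N ≤ (X2.card : ℝ)) (r : F) (hr : r ≠ 0)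
    (u v : F) (hu : u ≠ 0)
    (hs : ∀ x ∈ X1, ∀ y ∈ X2, u * (x + r * y) + v ∈ k • Z - k • Z) :
    β ^ (i + j + (12 * k - 1) + 10) * ((Z + sc r Z).card : ℝ) ≤ N := by
  have hβ := h.b0
  have hn := h.n0
  have hinj : Function.Injective (fun x : F => b * x + t) := by
    intro x y hxy
    simpa [hb] using hxy
  have hZ1 : X1.image (fun x => b * x + t) ⊆ Z := by
    intro z hz
    obtain ⟨y, hy, rfl⟩ := Finset.mem_image.1 hz
    exact h1 _ hy
  have hZ2 : X2.image (fun x => b * x + t) ⊆ Z := by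
    intro z hz
    obtain ⟨y, hy, rfl⟩ := Finset.mem_image.1 hz
    exact h2 _ hy
  have e := ruzsa2 Z _ _ hZ1 hZ2 r hr
  rw [Finset.card_image_of_injective _ hinj, Finset.card_image_of_injective _ hinj] at e
  have e2 : (X1.image (fun x => b * x + t) + sc r (X2.image (fun x => b * x + t))).card ≤
      (k • Z - k • Z).card := by
    apply Finset.card_le_card_of_injOn (fun z => u / b * (z - t - r * t) + v)
    · intro z hz
      obtain ⟨a, ha, c, hc, rfl⟩ := Finset.mem_add.1 (Finset.mem_coe.1 hz)
      obtain ⟨x, hx, rfl⟩ := Finset.mem_image.1 ha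
      obtain ⟨c', hc', rfl⟩ := Finset.mem_image.1 hc
      obtain ⟨y, hy, rfl⟩ := Finset.mem_image.1 hc'
      have := hs x hx y hy
      apply Finset.mem_coe.2
      convert this using 1
      field_simp
      ring
    · intro x _ y _ hxy
      have : u / b * (x - t - r * t) + v = u / b * (y - t - r * t) + v := hxy
      have h0 : u / b ≠ 0 := div_ne_zero hu hb
      simpa [h0] using this
  have e3 := h.plun k hk
  have eR : ((Z + sc r Z).card : ℝ) * (X1.card * X2.card) ≤
      (Z - Z).card * (Z - Z).card * (k • Z - k • Z).card := by
    have : (Z + sc r Z).card * (X1.card * X2.card) ≤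
      (Z - Z).card * (Z - Z).card * (k • Z - k • Z).card := e.trans (by gcongr)
    exact_mod_cast this
  set S : ℝ := ((Z + sc r Z).card : ℝ)
  set P : ℝ := ((k • Z - k • Z).card : ℝ)
  set D : ℝ := ((Z - Z).card : ℝ)
  have hD := h.dZ
  have key : (β ^ (i + j + (12 * k - 1) + 10) * S) * (N * N) ≤ N * (N * N) := by
    calc (β ^ (i + j + (12 * k - 1) + 10) * S) * (N * N)
        = β ^ (12 * k - 1) * β ^ 10 * (S * ((β ^ i * N) * (β ^ j * N))) := by
          rw [pow_add, pow_add, pow_add]; ring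
      _ ≤ β ^ (12 * k - 1) * β ^ 10 * (S * (X1.card * X2.card)) := by gcongr
      _ ≤ β ^ (12 * k - 1) * β ^ 10 * (D * D * P) := by gcongr
      _ = (β ^ 5 * D) * (β ^ 5 * D) * (β ^ (12 * k - 1) * P) := by ring
      _ ≤ N * N * N := by gcongr
      _ = N * (N * N) := by ring
  exact le_of_mul_le_mul_right key (by positivity)


lemma mem2 {Z : Finset F} {a b c d : F} (ha : a ∈ Z) (hb : b ∈ Z) (hc : c ∈ Z) (hd : d ∈ Z) :
    (a + b) - (c + d) ∈ 2 • Z - 2 • Z := by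
  rw [two_nsmul]
  exact Finset.sub_mem_sub (Finset.add_mem_add ha hb) (Finset.add_mem_add hc hd)

lemma mem3 {Z : Finset F} {a b c d e f : F} (ha : a ∈ Z) (hb : b ∈ Z) (he : e ∈ Z) (hc : c ∈ Z)
    (hd : d ∈ Z) (hf : f ∈ Z) :
    (a + b + e) - (c + d + f) ∈ 3 • Z - 3 • Z := by
  have : 3 • Z = Z + Z + Z := by rw [succ_nsmul, two_nsmul]
  rw [this]
  exact Finset.sub_mem_sub (Finset.add_mem_add (Finset.add_mem_add ha hb) he)
    (Finset.add_mem_add (Finset.add_mem_add hc hd) hf)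

lemma Conf.lemA {β N : ℝ} {X Z B : Finset F} (h : Conf β N X Z B) (b1 b2 b3 b4 : F)
    (h1 : b1 ∈ B) (h2 : b2 ∈ B) (h3 : b3 ∈ B) (h4 : b4 ∈ B) (h12 : b1 ≠ b2) (h34 : b3 ≠ b4) :
    β ^ 63 * ((Z + sc ((b1 - b2) / (b3 - b4)) Z).card : ℝ) ≤ N := by
  have hβ := h.b0
  obtain ⟨hb3, t3, ht3⟩ := h.mu b3 h3
  obtain ⟨X1, hX1, cX1, t4, ht4⟩ := h.shrinkX _ (Finset.filter_subset _ _ : X.filter (fun y => b3 * y + t3 ∈ Z) ⊆ X) b4 h4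
  obtain ⟨X2, hX2, cX2, t1, ht1⟩ := h.shrinkX _ (Finset.filter_subset _ _ : X.filter (fun y => b3 * y + t3 ∈ Z) ⊆ X) b1 h1
  obtain ⟨X3, hX3, cX3, t2, ht2⟩ := h.shrinkX X2 (hX2.trans (Finset.filter_subset _ _)) b2 h2
  have hu : b3 - b4 ≠ 0 := sub_ne_zero.2 h34
  have hw : b1 - b2 ≠ 0 := sub_ne_zero.2 h12
  have g := h.grow X1 X3 b3 t3 hb3 (fun x hx => (Finset.mem_filter.1 (hX1 hx)).2)
    (fun x hx => (Finset.mem_filter.1 (hX2 (hX3 hx))).2) 11 19 2 (by norm_num)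
    (by
      calc β ^ 11 * N = β ^ 8 * (β ^ 3 * N) := by ring
        _ ≤ _ := (mul_le_mul_of_nonneg_left ht3 (by positivity)).trans cX1)
    (by
      calc β ^ 19 * N = β ^ 8 * (β ^ 8 * (β ^ 3 * N)) := by ring
        _ ≤ _ := (mul_le_mul_of_nonneg_left ((mul_le_mul_of_nonneg_left ht3
          (by positivity)).trans cX2) (by positivity)).trans cX3)
    ((b1 - b2) / (b3 - b4)) (div_ne_zero hw hu) (b3 - b4) (t3 + t1 - (t4 + t2)) hu
    (by
      intro x hx y hy
      have := mem2 (Finset.mem_filter.1 (hX1 hx)).2 (ht1 y (hX3 hy)) (ht4 x hx) (ht2 y hy)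
      convert this using 1
      field_simp
      ring)
  exact g

lemma Conf.lemA' {β N : ℝ} {X Z B : Finset F} (h : Conf β N X Z B) (b1 b2 b3 b4 : F)
    (h1 : b1 ∈ B) (h2 : b2 ∈ B) (h3 : b3 ∈ B) (h4 : b4 ∈ B) (h34 : b3 ≠ b4)
    (hr : (b1 - b2) / (b3 - b4) - 1 ≠ 0) :
    β ^ 83 * ((Z + sc ((b1 - b2) / (b3 - b4) - 1) Z).card : ℝ) ≤ N := by
  have hβ := h.b0
  obtain ⟨hb3, t3, ht3⟩ := h.mu b3 h3
  obtain ⟨X1, hX1, cX1, t4, ht4⟩ := h.shrinkX _ (Finset.filter_subset _ _ : X.filter (fun y => b3 * y + t3 ∈ Z) ⊆ X) b4 h4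
  obtain ⟨X2, hX2, cX2, t1, ht1⟩ := h.shrinkX X1 (hX1.trans (Finset.filter_subset _ _)) b1 h1
  obtain ⟨X3, hX3, cX3, t2, ht2⟩ := h.shrinkX X2 (hX2.trans (hX1.trans (Finset.filter_subset _ _))) b2 h2
  have hu : b3 - b4 ≠ 0 := sub_ne_zero.2 h34
  have c1 : β ^ 11 * N ≤ X1.card := by
      calc β ^ 11 * N = β ^ 8 * (β ^ 3 * N) := by ring
        _ ≤ _ := (mul_le_mul_of_nonneg_left ht3 (by positivity)).trans cX1
  have g := h.grow X1 X3 b3 t3 hb3 (fun x hx => (Finset.mem_filter.1 (hX1 hx)).2)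
    (fun x hx => (Finset.mem_filter.1 (hX1 (hX2 (hX3 hx)))).2) 11 27 3 (by norm_num) c1
    (by
      calc β ^ 27 * N = β ^ 8 * (β ^ 8 * (β ^ 11 * N)) := by ring
        _ ≤ _ := (mul_le_mul_of_nonneg_left ((mul_le_mul_of_nonneg_left c1
          (by positivity)).trans cX2) (by positivity)).trans cX3)
    ((b1 - b2) / (b3 - b4) - 1) hr (b3 - b4) (t3 + t1 + t4 - (t4 + t2 + t3)) hu
    (by
      intro x hx y hy
      have := mem3 (Finset.mem_filter.1 (hX1 hx)).2 (ht1 y (hX3 hy)) (ht4 y (hX2 (hX3 hy)))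
        (ht4 x hx) (ht2 y hy) (Finset.mem_filter.1 (hX1 (hX2 (hX3 hy)))).2
      convert this using 1
      field_simp
      ring)
  exact g

/-- The quotient set. -/
def RR (Q0 : Finset F) : Set F :=
  {r : F | ∃ x1 ∈ Q0, ∃ x2 ∈ Q0, ∃ x3 ∈ Q0, ∃ x4 ∈ Q0, x3 ≠ x4 ∧ r = (x1 - x2) / (x3 - x4)}

/-- outside the quotient set sums are distinct -/
lemma inj_of_not_mem (Q0 : Finset F) (ξ ζ ζ' : F) (r : F) (hξ : ξ ≠ 0) (hr : r ∉ RR Q0)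
    (a a' c c' : F) (ha : a ∈ Q0) (ha' : a' ∈ Q0) (hc : c ∈ Q0) (hc' : c' ∈ Q0)
    (he : (ξ * a + ζ) + r * (ξ * c + ζ') = (ξ * a' + ζ) + r * (ξ * c' + ζ')) : a = a' ∧ c = c' := by
  have h : ξ * (a - a') = ξ * (r * (c' - c)) := by linear_combination he
  have h2 := mul_left_cancel₀ hξ h
  by_cases hcc : c = c'
  · subst hcc
    simp at h2
    exact ⟨sub_eq_zero.1 h2, rfl⟩
  · exfalso
    apply hr
    refine ⟨a, ha, a', ha', c', hc', c, hc, Ne.symm hcc, ?_⟩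
    rw [eq_div_iff (sub_ne_zero.2 (Ne.symm hcc))]
    exact h2.symm

/-- additive-multiplicative closure yields a subfield -/
lemma field_lemma [Finite F] (R : Set F) (h0 : (0 : F) ∈ R) (h1 : ∀ r ∈ R, r - 1 ∈ R)
    (M : Set F) (hM0 : ∀ m ∈ M, m ≠ 0) (hM : ∀ m ∈ M, ∀ r ∈ R, r * m ∈ R) :
    ∃ G : Subfield F, (∀ m ∈ M, m ∈ G) ∧ ∀ g ∈ G, g ∈ R := by
  have : Fintype F := Fintype.ofFinite F
  set n := Fintype.card F with hn
  have hn1 : 1 < n := Fintype.one_lt_card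
  obtain ⟨k, hk⟩ : ∃ k, n = k + 2 := ⟨n - 2, by omega⟩
  have hnz : ∀ s : F, n • s = 0 := fun s => by
    rw [hn, nsmul_eq_mul, FiniteField.cast_card_eq_zero, zero_mul]
  have hpw : ∀ g : F, g ≠ 0 → g⁻¹ = g ^ k := fun g hg => by
    have h := FiniteField.pow_card_sub_one_eq_one g hg
    rw [← hn, hk] at h
    have : g ^ k * g = 1 := by rw [← pow_succ]; exact h
    exact (eq_inv_of_mul_eq_one_left this).symm
  let S : Set F := {s | ∀ r ∈ R, r + s ∈ R}
  have S0 : (0 : F) ∈ S := fun r hr => by simpa using hr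
  have Sadd : ∀ s ∈ S, ∀ t ∈ S, s + t ∈ S := fun s hs t ht r hr => by
    rw [← add_assoc]; exact ht _ (hs r hr)
  have Smul : ∀ (m : ℕ), ∀ s ∈ S, m • s ∈ S := by
    intro m s hs
    induction m with
    | zero => simpa using S0
    | succ m ih => rw [succ_nsmul]; exact Sadd _ ih _ hs
  have Sneg : ∀ s ∈ S, -s ∈ S := by
    intro s hs
    have h := hnz s
    rw [hk, succ_nsmul] at h
    rw [← eq_neg_of_add_eq_zero_left h]
    exact Smul _ s hs
  have S1 : (1 : F) ∈ S := by
    have : (-1 : F) ∈ S := fun r hr => by rw [← sub_eq_add_neg]; exact h1 r hr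
    simpa using Sneg _ this
  let G0 : Set F := {g | ∀ s ∈ S, g * s ∈ S}
  have Gone : (1 : F) ∈ G0 := fun s hs => by simpa using hs
  have Gmul : ∀ a ∈ G0, ∀ b ∈ G0, a * b ∈ G0 := fun a ha b hb s hs => by
    rw [mul_assoc]; exact ha _ (hb s hs)
  have Gpow : ∀ a ∈ G0, ∀ m : ℕ, a ^ m ∈ G0 := by
    intro a ha m
    induction m with
    | zero => simpa using Gone
    | succ m ih => rw [pow_succ]; exact Gmul _ ih _ ha
  have Gzero : (0 : F) ∈ G0 := fun s hs => by simpa using S0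
  let G : Subfield F :=
    { carrier := G0
      mul_mem' := fun {a b} ha hb => Gmul a ha b hb
      one_mem' := Gone
      add_mem' := fun {a b} ha hb s hs => by
        rw [add_mul]; exact Sadd _ (ha s hs) _ (hb s hs)
      zero_mem' := Gzero
      neg_mem' := fun {a} ha s hs => by
        rw [neg_mul]; exact Sneg _ (ha s hs)
      inv_mem' := fun a ha => by
        by_cases h : a = 0
        · subst h; rw [inv_zero]; exact Gzero
        · rw [hpw a h]; exact Gpow a ha k }
  refine ⟨G, ?_, ?_⟩
  · intro m hm s hs r hr
    have hm0 := hM0 m hm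
    have hp : ∀ j : ℕ, r * m ^ j ∈ R := by
      intro j
      induction j with
      | zero => simpa using hr
      | succ j ih => rw [pow_succ, ← mul_assoc]; exact hM m hm _ ih
    have h2 := hM m hm _ (hs _ (hp k))
    rw [← hpw m hm0] at h2
    convert h2 using 1
    field_simp
  · intro g hg
    have h2 := (show g ∈ G0 from hg) 1 S1 0 h0
    simpa using h2


lemma energy_le (Q : Finset F) (r : F) (hr : r ≠ 0) :
    Finset.addEnergy Q (sc r Q) ≤ Q.card ^ 2 + (((Q ×ˢ Q) ×ˢ (Q ×ˢ Q)).filter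
      (fun x => x.2.1 ≠ x.2.2 ∧ (x.1.2 - x.1.1) / (x.2.1 - x.2.2) = r)).card := by
  have h1 : (((Q ×ˢ Q) ×ˢ (Q ×ˢ Q)).filter
      (fun x => x.2.1 = x.2.2 ∧ x.1.1 = x.1.2)).card ≤ Q.card ^ 2 := by
    rw [sq, ← Finset.card_product]
    apply Finset.card_le_card_of_injOn (fun x => (x.1.1, x.2.1))
    · intro x hx
      simp only [Finset.coe_filter, Finset.mem_product, Set.mem_ofPred_eq, Finset.coe_product,
        Set.mem_prod, Finset.mem_coe] at hx ⊢
      tauto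
    · rintro ⟨⟨a, b⟩, ⟨c, d⟩⟩ hx ⟨⟨a', b'⟩, ⟨c', d'⟩⟩ hy hxy
      simp only [Finset.coe_filter, Finset.mem_product, Set.mem_ofPred_eq, Prod.mk.injEq]
        at hx hy hxy ⊢
      obtain ⟨_, rfl, rfl⟩ := hx
      obtain ⟨_, rfl, rfl⟩ := hy
      tauto
  refine le_trans ?_ (Nat.add_le_add_right h1 _)
  refine le_trans ?_ (Finset.card_union_le _ _)
  unfold Finset.addEnergy
  refine le_trans (Finset.card_le_card ?_) (Finset.card_image_le
    (f := fun x : (F × F) × (F × F) => (x.1, (r * x.2.1, r * x.2.2))))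
  rintro ⟨⟨a, b⟩, ⟨c, d⟩⟩ hx
  rw [Finset.mem_filter] at hx
  obtain ⟨hx, he⟩ := hx
  simp only [Finset.mem_product] at hx
  obtain ⟨⟨ha, hb⟩, hc, hd⟩ := hx
  obtain ⟨c', hc', rfl⟩ := Finset.mem_image.1 hc
  obtain ⟨d', hd', rfl⟩ := Finset.mem_image.1 hd
  rw [Finset.mem_image]
  refine ⟨((a, b), (c', d')), ?_, rfl⟩
  simp only at he
  by_cases hcd : c' = d'
  · subst hcd
    apply Finset.mem_union_left
    simp only [Finset.mem_filter, Finset.mem_product]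
    exact ⟨⟨⟨ha, hb⟩, hc', hd'⟩, trivial, by simpa using he⟩
  · apply Finset.mem_union_right
    simp only [Finset.mem_filter, Finset.mem_product]
    refine ⟨⟨⟨ha, hb⟩, hc', hd'⟩, hcd, ?_⟩
    rw [div_eq_iff (sub_ne_zero.2 hcd)]
    linear_combination -he

lemma size_le (Q Γ : Finset F) (S : ℝ) (hQ : 0 < Q.card) (hS0 : 0 ≤ S)
    (hΓ : ∀ r ∈ Γ, r ≠ 0 ∧ ((Q + sc r Q).card : ℝ) ≤ S) (hS : 2 * S ≤ (Q.card : ℝ) ^ 2) :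
    (Γ.card : ℝ) ≤ 2 * S := by
  set n : ℝ := (Q.card : ℝ) with hn
  have hn0 : 0 < n := by rw [hn]; exact_mod_cast hQ
  set V : F → Finset ((F × F) × (F × F)) := fun r => ((Q ×ˢ Q) ×ˢ (Q ×ˢ Q)).filter
      (fun x => x.2.1 ≠ x.2.2 ∧ (x.1.2 - x.1.1) / (x.2.1 - x.2.2) = r) with hV
  have h1 : ∑ r ∈ Γ, (V r).card ≤ Q.card ^ 4 := by
    rw [← Finset.card_biUnion]
    · have : Q.card ^ 4 = ((Q ×ˢ Q) ×ˢ (Q ×ˢ Q)).card := by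
        simp only [Finset.card_product]; ring
      rw [this]
      apply Finset.card_le_card
      rw [Finset.biUnion_subset]
      intro r _
      exact Finset.filter_subset _ _
    · intro r _ r' _ hrr
      rw [Function.onFun, Finset.disjoint_left]
      intro x hx hx'
      exact hrr ((Finset.mem_filter.1 hx).2.2.symm.trans (Finset.mem_filter.1 hx').2.2)
  have h1' : ∑ r ∈ Γ, ((V r).card : ℝ) ≤ n ^ 4 := by rw [hn]; exact_mod_cast h1
  have h2 : ∀ r ∈ Γ, n ^ 4 ≤ S * (n ^ 2 + (V r).card) := by
    intro r hr
    obtain ⟨hr0, hrS⟩ := hΓ r hr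
    have e := Finset.le_card_add_mul_addEnergy Q (sc r Q)
    have c2 : (sc r Q).card = Q.card := Finset.card_image_of_injective _ (mul_right_injective₀ hr0)
    rw [c2] at e
    have e' : Q.card ^ 2 * Q.card ^ 2 ≤ (Q + sc r Q).card * (Q.card ^ 2 + (V r).card) :=
      e.trans (Nat.mul_le_mul_left _ (energy_le Q r hr0))
    have e'' : n ^ 2 * n ^ 2 ≤ ((Q + sc r Q).card : ℝ) * (n ^ 2 + (V r).card) := by
      rw [hn]; exact_mod_cast e'
    calc n ^ 4 = n ^ 2 * n ^ 2 := by ring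
      _ ≤ _ := e''
      _ ≤ _ := by gcongr
  have h3 := Finset.sum_le_sum h2
  rw [Finset.sum_const, ← Finset.mul_sum, Finset.sum_add_distrib, Finset.sum_const, nsmul_eq_mul,
    nsmul_eq_mul] at h3
  have h4 : (Γ.card : ℝ) * n ^ 4 ≤ S * (Γ.card * n ^ 2 + n ^ 4) :=
    h3.trans (by gcongr)
  have h5 : (Γ.card : ℝ) * n ^ 2 * (2 * S) ≤ (Γ.card : ℝ) * n ^ 2 * n ^ 2 := by gcongr
  have h6 : (Γ.card : ℝ) * n ^ 4 ≤ (2 * S) * n ^ 4 := by nlinarith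
  exact le_of_mul_le_mul_right h6 (by positivity)

lemma RR_neg_one_aux {Q0 : Finset F} (h : 1 < Q0.card) : (0 : F) ∈ RR Q0 := by
  obtain ⟨a, ha, b, hb, hab⟩ := Finset.one_lt_card.1 h
  exact ⟨a, ha, a, ha, a, ha, b, hb, hab, by simp⟩

lemma Conf.propG [Finite F] {β N : ℝ} {X Z B : Finset F} (h : Conf β N X Z B) (Q0 : Finset F)
    (hQB : Q0 ⊆ B) (cQ : β ^ 4 * N ≤ (Q0.card : ℝ)) (ξ ζ : F) (hξ : ξ ≠ 0)
    (hQ : ∀ b ∈ Q0, ξ * b + ζ ∈ Z) (hN : 2 < β ^ 91 * N) (b0 : F) (hb0 : b0 ∈ B) :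
    ∃ G : Subfield F, (∀ b ∈ B, ∃ g ∈ G, b = b0 * g) ∧ β ^ 63 * (Nat.card G : ℝ) ≤ 3 * N := by
  have hβ := h.b0
  have hβ1 := h.b1
  have hn := h.n0
  have hpow : ∀ k, k ≤ 91 → 2 < β ^ k * N := by
    intro k hk
    refine lt_of_lt_of_le hN ?_
    gcongr ?_ * N
    exact pow_le_pow_of_le_one hβ.le hβ1 hk
  have hQ1 : 1 < Q0.card := by
    have := (hpow 4 (by norm_num)).trans_le cQ
    have : (1 : ℝ) < Q0.card := by linarith
    exact_mod_cast this
  have h0 := RR_neg_one_aux hQ1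
  have hsub : ∀ r ∈ RR Q0, r - 1 ∈ RR Q0 := by
    intro r hr
    by_contra hcon
    obtain ⟨b1, h1, b2, h2, b3, h3, b4, h4, h34, rfl⟩ := hr
    have hr0 : (b1 - b2) / (b3 - b4) - 1 ≠ 0 := by
      intro h; rw [h] at hcon; exact hcon h0
    have e := h.lemA' b1 b2 b3 b4 (hQB h1) (hQB h2) (hQB h3) (hQB h4) h34 hr0
    set r := (b1 - b2) / (b3 - b4) - 1 with hr
    have e2 : (Q0 ×ˢ Q0).card ≤ (Z + sc r Z).card := by
      apply Finset.card_le_card_of_injOn (fun p => (ξ * p.1 + ζ) + r * (ξ * p.2 + ζ))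
      · intro p hp
        have hp := Finset.mem_product.1 (Finset.mem_coe.1 hp)
        exact Finset.mem_coe.2 (Finset.add_mem_add (hQ _ hp.1)
          (Finset.mem_image_of_mem _ (hQ _ hp.2)))
      · intro p hp p' hp' he
        have hp := Finset.mem_product.1 (Finset.mem_coe.1 hp)
        have hp' := Finset.mem_product.1 (Finset.mem_coe.1 hp')
        have := inj_of_not_mem Q0 ξ ζ ζ r hξ hcon _ _ _ _ hp.1 hp'.1 hp.2 hp'.2 he
        exact Prod.ext this.1 this.2
    have e3 : (Q0.card : ℝ) * Q0.card ≤ (Z + sc r Z).card := by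
      rw [Finset.card_product] at e2; exact_mod_cast e2
    have e4 : β ^ 83 * ((β ^ 4 * N) * (β ^ 4 * N)) ≤ N :=
      le_trans (by gcongr) ((mul_le_mul_of_nonneg_left e3 (by positivity)).trans e)
    have e5 : (β ^ 91 * N) * N ≤ 1 * N := by
      calc _ = β ^ 83 * ((β ^ 4 * N) * (β ^ 4 * N)) := by ring
        _ ≤ _ := by linarith
    have := le_of_mul_le_mul_right e5 hn
    linarith
  have hmul : ∀ m ∈ {m : F | ∃ b ∈ B, m = b / b0}, ∀ r ∈ RR Q0, r * m ∈ RR Q0 := by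
    rintro m ⟨b, hb, rfl⟩ r hr
    by_contra hcon
    obtain ⟨b1, h1, b2, h2, b3, h3, b4, h4, h34, rfl⟩ := hr
    have h12 : b1 ≠ b2 := by
      rintro rfl; simp only [sub_self, zero_div, zero_mul] at hcon; exact hcon h0
    have e := h.lemA b1 b2 b3 b4 (hQB h1) (hQB h2) (hQB h3) (hQB h4) h12 h34
    set r := (b1 - b2) / (b3 - b4) with hr
    have hinj : Function.Injective (fun x : F => ξ * x + ζ) := by
      intro x y hxy
      simpa [hξ] using hxy
    obtain ⟨U1, hU1, cU1, t, ht⟩ := h.shrinkZ (Q0.image (fun x => ξ * x + ζ)) (by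
      intro z hz
      obtain ⟨y, hy, rfl⟩ := Finset.mem_image.1 hz
      exact hQ _ hy) b0 b hb0 hb
    rw [Finset.card_image_of_injective _ hinj] at cU1
    set Q1 := Q0.filter (fun x => ξ * x + ζ ∈ U1) with hQ1d
    have c1 : U1.card ≤ Q1.card := by
      refine le_trans (Finset.card_le_card ?_) (Finset.card_image_le
        (s := Q1) (f := fun x => ξ * x + ζ))
      intro x hx
      obtain ⟨u, hu, rfl⟩ := Finset.mem_image.1 (hU1 hx)
      exact Finset.mem_image_of_mem _ (Finset.mem_filter.2 ⟨hu, hx⟩)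
    have c1' : (U1.card : ℝ) ≤ Q1.card := by exact_mod_cast c1
    have e2 : (Q0 ×ˢ Q1).card ≤ (Z + sc r Z).card := by
      apply Finset.card_le_card_of_injOn
        (fun p => (ξ * p.1 + ζ) + r * (b / b0 * (ξ * p.2 + ζ) + t))
      · intro p hp
        have hp := Finset.mem_product.1 (Finset.mem_coe.1 hp)
        exact Finset.mem_coe.2 (Finset.add_mem_add (hQ _ hp.1)
          (Finset.mem_image_of_mem _ (ht _ (Finset.mem_filter.1 hp.2).2)))
      · intro p hp p' hp' he
        have hp := Finset.mem_product.1 (Finset.mem_coe.1 hp)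
        have hp' := Finset.mem_product.1 (Finset.mem_coe.1 hp')
        have he' : (ξ * p.1 + ζ) + r * (b / b0 * (ξ * p.2 + ζ) + t) =
          (ξ * p'.1 + ζ) + r * (b / b0 * (ξ * p'.2 + ζ) + t) := he
        have := inj_of_not_mem Q0 ξ ζ ζ (r * (b / b0)) hξ hcon _ _ _ _ hp.1 hp'.1
          (Finset.mem_filter.1 hp.2).1 (Finset.mem_filter.1 hp'.2).1 (by linear_combination he')
        exact Prod.ext this.1 this.2
    have e3 : (Q0.card : ℝ) * Q1.card ≤ (Z + sc r Z).card := by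
      rw [Finset.card_product] at e2; exact_mod_cast e2
    have c2 : β ^ 20 * N ≤ Q1.card := by
      calc β ^ 20 * N = β ^ 16 * (β ^ 4 * N) := by ring
        _ ≤ β ^ 16 * Q0.card := by gcongr
        _ ≤ _ := cU1.trans c1'
    have e4 : β ^ 63 * ((β ^ 4 * N) * (β ^ 20 * N)) ≤ N :=
      le_trans (by gcongr) ((mul_le_mul_of_nonneg_left e3 (by positivity)).trans e)
    have e5 : (β ^ 87 * N) * N ≤ 1 * N := by
      calc _ = β ^ 63 * ((β ^ 4 * N) * (β ^ 20 * N)) := by ring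
        _ ≤ _ := by linarith
    have := le_of_mul_le_mul_right e5 hn
    linarith [hpow 87 (by norm_num)]
  obtain ⟨G, hG1, hG2⟩ := field_lemma (RR Q0) h0 hsub {m : F | ∃ b ∈ B, m = b / b0} (by
    rintro m ⟨b, hb, rfl⟩
    exact div_ne_zero (h.mu b hb).1 (h.mu b0 hb0).1) hmul
  refine ⟨G, ?_, ?_⟩
  · intro b hb
    refine ⟨b / b0, hG1 _ ⟨b, hb, rfl⟩, ?_⟩
    have := (h.mu b0 hb0).1
    field_simp
  · have : Fintype F := Fintype.ofFinite F
    set Γ : Finset F := Finset.univ.filter (fun g => g ∈ G ∧ g ≠ 0) with hΓ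
    have hcard : Nat.card G ≤ Γ.card + 1 := by
      have e1 : Nat.card G = (Finset.univ.filter (fun g => g ∈ G)).card := by
        rw [Nat.card_eq_fintype_card]
        exact Fintype.card_subtype _
      rw [e1]
      have : (Finset.univ.filter (fun g => g ∈ G)) ⊆ insert 0 Γ := by
        intro g hg
        by_cases hg0 : g = 0
        · simp [hg0]
        · apply Finset.mem_insert_of_mem
          simp only [hΓ, Finset.mem_filter, Finset.mem_univ, true_and] at hg ⊢
          exact ⟨hg, hg0⟩
      exact (Finset.card_le_card this).trans (Finset.card_insert_le _ _)
    have hsz := size_le Q0 Γ (N / β ^ 63) (by omega) (by positivity) (by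
      intro r hr
      simp only [hΓ, Finset.mem_filter, Finset.mem_univ, true_and] at hr
      refine ⟨hr.2, ?_⟩
      obtain ⟨b1, h1, b2, h2, b3, h3, b4, h4, h34, rfl⟩ := hG2 r hr.1
      have h12 : b1 ≠ b2 := by
        rintro rfl; simp at hr
      have e := h.lemA b1 b2 b3 b4 (hQB h1) (hQB h2) (hQB h3) (hQB h4) h12 h34
      set r := (b1 - b2) / (b3 - b4) with hr
      rw [le_div_iff₀ (by positivity), mul_comm]
      refine le_trans ?_ e
      have : (Q0 + sc r Q0).card ≤ (Z + sc r Z).card := by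
        apply Finset.card_le_card_of_injOn (fun z => ξ * z + (ζ + r * ζ))
        · intro z hz
          obtain ⟨a, ha, c, hc, rfl⟩ := Finset.mem_add.1 (Finset.mem_coe.1 hz)
          obtain ⟨d, hd, rfl⟩ := Finset.mem_image.1 hc
          apply Finset.mem_coe.2
          have := Finset.add_mem_add (hQ _ ha)
            (Finset.mem_image_of_mem (fun z => r * z) (hQ _ hd))
          have e1 : ξ * (a + r * d) + (ζ + r * ζ) = (ξ * a + ζ) + r * (ξ * d + ζ) := by ring
          simp only [e1]
          exact this
        · intro x _ y _ hxy
          simpa [hξ] using hxy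
      gcongr) (by
      rw [← mul_div_assoc, div_le_iff₀ (by positivity)]
      have e1 : (β ^ 4 * N) ^ 2 ≤ (Q0.card : ℝ) ^ 2 := by gcongr
      have e2 := hpow 71 (by norm_num)
      calc 2 * N ≤ (β ^ 71 * N) * N := by gcongr
        _ = (β ^ 4 * N) ^ 2 * β ^ 63 := by ring
        _ ≤ _ := by gcongr)
    have hcard' : (Nat.card G : ℝ) ≤ Γ.card + 1 := by exact_mod_cast hcard
    have hN1 : 2 < N := by simpa using hpow 0 (by norm_num)
    calc β ^ 63 * (Nat.card G : ℝ) ≤ β ^ 63 * (2 * (N / β ^ 63) + 1) := by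
          gcongr; linarith
      _ = 2 * N + β ^ 63 := by field_simp
      _ ≤ 3 * N := by
          have : β ^ 63 ≤ 1 := pow_le_one₀ hβ.le hβ1
          linarith


/-- Neighbourhoods. -/
def XX (A : Finset F) (L : F → F → F → Prop) (c : F × F) : Finset F :=
  A.filter (fun v => L c.1 v c.2)

/-- Codegrees. -/
def cd (A : Finset F) (L : F → F → F → Prop) (b y y' : F) : ℕ :=
  (A.filter (fun w => L b y w ∧ L b y' w)).card

/-- Vertices with small codegree. -/
def bad (A : Finset F) (L : F → F → F → Prop) (θ : ℝ) (c : F × F) (y : F) : Finset F :=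
  (XX A L c).filter (fun y' => (cd A L c.1 y y' : ℝ) < θ)

/-- Good part of a neighbourhood. -/
def XP (A : Finset F) (L : F → F → F → Prop) (θ : ℝ) (c : F × F) : Finset F :=
  (XX A L c).filter (fun y => 4 * (bad A L θ c y).card ≤ (XX A L c).card)

lemma bp_sum (I A : Finset F) (L : F → F → F → Prop) (θ : ℝ) (hθ : 0 ≤ θ) :
    ∑ c ∈ I ×ˢ A, ∑ y ∈ XX A L c, ((bad A L θ c y).card : ℝ) ≤
      I.card * (A.card : ℝ) ^ 2 * θ := by
  rw [Finset.sum_product]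
  have key : ∀ b ∈ I, ∑ w ∈ A, ∑ y ∈ XX A L (b, w), ((bad A L θ (b, w) y).card : ℝ) ≤
      (A.card : ℝ) ^ 2 * θ := by
    intro b _
    have h1 : ∀ w ∈ A, ∑ y ∈ XX A L (b, w), ((bad A L θ (b, w) y).card : ℝ) =
        ∑ y ∈ A, ∑ y' ∈ A, (if (L b y w ∧ L b y' w) ∧ (cd A L b y y' : ℝ) < θ then (1 : ℝ) else 0) := by
      intro w _
      unfold XX
      rw [Finset.sum_filter]
      apply Finset.sum_congr rfl
      intro y _
      by_cases hy : L b y w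
      · simp only [hy, if_true, true_and]
        unfold bad XX
        rw [Finset.filter_filter, Finset.card_filter]
        push_cast
        rfl
      · simp [hy]
    rw [Finset.sum_congr rfl h1, Finset.sum_comm]
    have h2 : ∀ y ∈ A, ∑ w ∈ A, ∑ y' ∈ A,
        (if (L b y w ∧ L b y' w) ∧ (cd A L b y y' : ℝ) < θ then (1 : ℝ) else 0) ≤ A.card * θ := by
      intro y _
      rw [Finset.sum_comm, ← nsmul_eq_mul]
      apply Finset.sum_le_card_nsmul
      intro y' _
      by_cases hc : (cd A L b y y' : ℝ) < θ
      · simp only [hc, and_true]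
        refine le_trans (le_of_eq ?_) hc.le
        unfold cd
        rw [Finset.card_filter]
        push_cast
        rfl
      · simpa [hc] using hθ
    calc _ ≤ A.card • (A.card * θ) := Finset.sum_le_card_nsmul _ _ _ h2
      _ = _ := by rw [nsmul_eq_mul]; ring
  calc _ ≤ I.card • ((A.card : ℝ) ^ 2 * θ) := Finset.sum_le_card_nsmul _ _ _ key
    _ = _ := by rw [nsmul_eq_mul]; ring

lemma diff_bound (A S : Finset F) (L : F → F → F → Prop) (θ : ℝ) (hθ : 0 ≤ θ) (c : F × F)
    (l m : F) (hl : l ≠ 0) (hm : m ≠ 0)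
    (hS : ∀ v ∈ A, ∀ w ∈ A, L c.1 v w → l * v + m * w ∈ S) :
    ((XP A L θ c - XP A L θ c).card : ℝ) * (((XX A L c).card : ℝ) / 2 * θ ^ 2) ≤
      (S.card : ℝ) ^ 4 := by
  set X := XX A L c with hX
  set D := XP A L θ c - XP A L θ c with hD
  have hrep : ∀ d, ∃ p : F × F, d ∈ D → p.1 ∈ XP A L θ c ∧ p.2 ∈ XP A L θ c ∧ p.1 - p.2 = d := by
    intro d
    by_cases hd : d ∈ D
    · obtain ⟨a, ha, b, hb, hab⟩ := Finset.mem_sub.1 hd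
      exact ⟨(a, b), fun _ => ⟨ha, hb, hab⟩⟩
    · exact ⟨(0, 0), fun h => absurd h hd⟩
  choose p hp using hrep
  set W : F → Finset ((_ : F) × F × F) := fun d => X.sigma (fun y =>
    (A.filter (fun w => L c.1 (p d).1 w ∧ L c.1 y w)) ×ˢ
    (A.filter (fun w => L c.1 (p d).2 w ∧ L c.1 y w))) with hW
  have hXA : ∀ {y}, y ∈ X → y ∈ A := fun hy => (Finset.mem_filter.1 hy).1
  have hPX : ∀ {y}, y ∈ XP A L θ c → y ∈ X := fun hy => (Finset.mem_filter.1 hy).1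
  have hWc : ∀ d ∈ D, (X.card : ℝ) / 2 * θ ^ 2 ≤ ((W d).card : ℝ) := by
    intro d hd
    obtain ⟨h1, h2, _⟩ := hp d hd
    have b1 : 4 * (bad A L θ c (p d).1).card ≤ X.card := (Finset.mem_filter.1 h1).2
    have b2 : 4 * (bad A L θ c (p d).2).card ≤ X.card := (Finset.mem_filter.1 h2).2
    rw [hW, Finset.card_sigma]
    push_cast
    have hgood : (X.card : ℝ) / 2 ≤
        ((X \ (bad A L θ c (p d).1 ∪ bad A L θ c (p d).2)).card : ℝ) := by
      have e1 := Finset.le_card_sdiff (bad A L θ c (p d).1 ∪ bad A L θ c (p d).2) X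
      have e2 := Finset.card_union_le (bad A L θ c (p d).1) (bad A L θ c (p d).2)
      have e3 : X.card ≤ 2 * (X \ (bad A L θ c (p d).1 ∪ bad A L θ c (p d).2)).card := by omega
      have e3' : (X.card : ℝ) ≤
        2 * ((X \ (bad A L θ c (p d).1 ∪ bad A L θ c (p d).2)).card : ℝ) := by exact_mod_cast e3
      linarith
    calc (X.card : ℝ) / 2 * θ ^ 2
        ≤ ((X \ (bad A L θ c (p d).1 ∪ bad A L θ c (p d).2)).card : ℝ) * θ ^ 2 := by gcongr
      _ = ∑ y ∈ X \ (bad A L θ c (p d).1 ∪ bad A L θ c (p d).2), θ ^ 2 := by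
          rw [Finset.sum_const, nsmul_eq_mul]
      _ ≤ ∑ y ∈ X \ (bad A L θ c (p d).1 ∪ bad A L θ c (p d).2),
          (((A.filter (fun w => L c.1 (p d).1 w ∧ L c.1 y w)) ×ˢ
            (A.filter (fun w => L c.1 (p d).2 w ∧ L c.1 y w))).card : ℝ) := by
          apply Finset.sum_le_sum
          intro y hy
          rw [Finset.mem_sdiff, Finset.mem_union, not_or] at hy
          obtain ⟨hyX, hn1, hn2⟩ := hy
          have g1 : θ ≤ cd A L c.1 (p d).1 y := by
            by_contra hcon
            exact hn1 (Finset.mem_filter.2 ⟨hyX, not_le.1 hcon⟩)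
          have g2 : θ ≤ cd A L c.1 (p d).2 y := by
            by_contra hcon
            exact hn2 (Finset.mem_filter.2 ⟨hyX, not_le.1 hcon⟩)
          rw [Finset.card_product, sq]
          push_cast
          exact mul_le_mul g1 g2 hθ (by positivity)
      _ ≤ _ := by
          apply Finset.sum_le_sum_of_subset_of_nonneg Finset.sdiff_subset
          intros; positivity
  have hinj : (D.sigma W).card ≤ ((S ×ˢ S) ×ˢ (S ×ˢ S)).card := by
    apply Finset.card_le_card_of_injOn (fun x : (_ : F) × (_ : F) × F × F =>
      ((l * (p x.1).1 + m * x.2.2.1, l * x.2.1 + m * x.2.2.1),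
       (l * x.2.1 + m * x.2.2.2, l * (p x.1).2 + m * x.2.2.2)))
    · rintro ⟨d, y, w, w'⟩ hx
      simp only [hW, Finset.coe_sigma, Set.mem_sigma_iff, Finset.mem_coe, Finset.mem_sigma,
        Finset.mem_product, Finset.mem_filter] at hx
      obtain ⟨hd, hy, ⟨hw, hw1, hw2⟩, hw', hw1', hw2'⟩ := hx
      obtain ⟨h1, h2, _⟩ := hp d hd
      simp only [Finset.coe_product, Set.mem_prod, Finset.mem_coe]
      exact ⟨⟨hS _ (hXA (hPX h1)) _ hw hw1, hS _ (hXA hy) _ hw hw2⟩,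
        hS _ (hXA hy) _ hw' hw2', hS _ (hXA (hPX h2)) _ hw' hw1'⟩
    · rintro ⟨d, y, w, w'⟩ hx ⟨d2, y2, w2, w2'⟩ hx2 he
      simp only [Finset.coe_sigma, Set.mem_sigma_iff, Finset.mem_coe] at hx hx2
      simp only [Prod.mk.injEq] at he
      obtain ⟨⟨e1, e2⟩, e3, e4⟩ := he
      have r1 := (hp d hx.1).2.2
      have r2 := (hp d2 hx2.1).2.2
      have hdd : d = d2 := by
        apply mul_left_cancel₀ hl
        rw [← r1, ← r2]
        linear_combination e1 - e2 + e3 - e4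
      subst hdd
      have hw : w = w2 := by
        apply mul_left_cancel₀ hm
        linear_combination e1
      subst hw
      have hy : y = y2 := by
        apply mul_left_cancel₀ hl
        linear_combination e2
      subst hy
      have hw' : w' = w2' := by
        apply mul_left_cancel₀ hm
        linear_combination e3
      subst hw'
      rfl
  have hinj' : ((D.sigma W).card : ℝ) ≤ (S.card : ℝ) ^ 4 := by
    have : ((S ×ˢ S) ×ˢ (S ×ˢ S)).card = S.card ^ 4 := by
      simp only [Finset.card_product]; ring
    rw [this] at hinj
    exact_mod_cast hinj
  refine le_trans ?_ hinj'
  rw [Finset.card_sigma]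
  push_cast
  rw [← nsmul_eq_mul]
  exact Finset.card_nsmul_le_sum _ _ _ hWc

lemma bp_pt (A : Finset F) (L : F → F → F → Prop) (θ : ℝ) (c : F × F) :
    (((XX A L c).card : ℝ) - (XP A L θ c).card) * (((XX A L c).card : ℝ) / 4) ≤
      ∑ y ∈ XX A L c, ((bad A L θ c y).card : ℝ) := by
  have hsub : XP A L θ c ⊆ XX A L c := Finset.filter_subset _ _
  have s1 : (((XX A L c) \ (XP A L θ c)).card : ℝ) = (XX A L c).card - (XP A L θ c).card := by
    rw [Finset.card_sdiff_of_subset hsub, Nat.cast_sub (Finset.card_le_card hsub)]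
  rw [← s1, ← nsmul_eq_mul]
  refine le_trans (Finset.card_nsmul_le_sum _ (fun y => ((bad A L θ c y).card : ℝ)) _ ?_)
    (Finset.sum_le_sum_of_subset_of_nonneg Finset.sdiff_subset
      (fun _ _ _ => Nat.cast_nonneg _))
  intro y hy
  rw [Finset.mem_sdiff] at hy
  have h1 : ¬ (4 * (bad A L θ c y).card ≤ (XX A L c).card) :=
    fun h => hy.2 (Finset.mem_filter.2 ⟨hy.1, h⟩)
  have h2 : (XX A L c).card ≤ 4 * (bad A L θ c y).card := by omega
  have h3 : ((XX A L c).card : ℝ) ≤ 4 * ((bad A L θ c y).card : ℝ) := by exact_mod_cast h2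
  linarith

lemma real_pt (x x' bp M : ℝ) (hbp0 : 0 ≤ bp) (hx0 : 0 ≤ x) (hx'0 : 0 ≤ x') (hle : x' ≤ x)
    (e1 : (x - x') * (x / 4) ≤ bp) (hM : 0 < M) :
    x ≤ (if M / 8 ≤ x ∧ x / 2 ≤ x' then x' else 0) + (M / 8 + 64 / M * bp) := by
  by_cases h1 : M / 8 ≤ x
  · have e2 : ∀ t, t * M ≤ 64 * bp → t ≤ 64 / M * bp := by
      intro t ht
      rw [div_mul_eq_mul_div, le_div_iff₀ hM]
      exact ht
    by_cases h2 : x / 2 ≤ x'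
    · rw [if_pos ⟨h1, h2⟩]
      have := e2 (x - x') (by nlinarith)
      linarith
    · rw [if_neg (fun h => h2 h.2)]
      have := e2 x (by nlinarith)
      linarith
  · rw [if_neg (fun h => h1 h.1)]
    have : 0 ≤ 64 / M * bp := by positivity
    linarith

lemma lemma1 (I A : Finset F) (L : F → F → F → Prop) (l m : F → F) (S : F → Finset F) (α : ℝ)
    (hα : 0 < α) (hA : 0 < A.card) (hl : ∀ b ∈ I, l b ≠ 0) (hm : ∀ b ∈ I, m b ≠ 0)
    (hSc : ∀ b ∈ I, (S b).card ≤ A.card)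
    (hS : ∀ b ∈ I, ∀ v ∈ A, ∀ w ∈ A, L b v w → l b * v + m b * w ∈ S b)
    (hE : α * I.card * (A.card : ℝ) ^ 2 ≤ ∑ c ∈ I ×ˢ A, ((XX A L c).card : ℝ)) :
    ∃ (Ch : Finset (F × F)) (Xp : F × F → Finset F), Ch ⊆ I ×ˢ A ∧
      (∀ c ∈ Ch, Xp c ⊆ XX A L c) ∧ (∀ c ∈ Ch, α * A.card / 16 ≤ ((Xp c).card : ℝ)) ∧
      (∀ c ∈ Ch, α ^ 5 * ((Xp c - Xp c).card : ℝ) ≤ 2 ^ 24 * A.card) ∧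
      13 / 16 * ∑ c ∈ I ×ˢ A, ((XX A L c).card : ℝ) ≤ ∑ c ∈ Ch, ((Xp c).card : ℝ) := by
  set N : ℝ := (A.card : ℝ) with hN
  have hN0 : 0 < N := by rw [hN]; exact_mod_cast hA
  set θ : ℝ := α ^ 2 / 1024 * N with hθ
  have hθ0 : 0 < θ := by positivity
  set P : F × F → Prop := fun c => α * N / 8 ≤ ((XX A L c).card : ℝ) ∧
    ((XX A L c).card : ℝ) / 2 ≤ ((XP A L θ c).card : ℝ) with hP
  have hsub : ∀ c, XP A L θ c ⊆ XX A L c := fun c => Finset.filter_subset _ _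
  refine ⟨(I ×ˢ A).filter P, XP A L θ, Finset.filter_subset _ _, fun c _ => hsub c, ?_, ?_, ?_⟩
  · intro c hc
    obtain ⟨_, h1, h2⟩ := Finset.mem_filter.1 hc
    linarith
  · intro c hc
    obtain ⟨hc, h1, h2⟩ := Finset.mem_filter.1 hc
    have hcI := (Finset.mem_product.1 hc).1
    have e := diff_bound A (S c.1) L θ hθ0.le c (l c.1) (m c.1) (hl _ hcI) (hm _ hcI) (hS _ hcI)
    have e1 : ((S c.1).card : ℝ) ≤ N := by rw [hN]; exact_mod_cast hSc _ hcI
    set D : ℝ := ((XP A L θ c - XP A L θ c).card : ℝ)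
    have e2 : D * (α * N / 8 / 2 * θ ^ 2) ≤ N ^ 4 :=
      le_trans (by gcongr) (e.trans (by gcongr))
    have e3 : α ^ 5 * D * N ^ 3 ≤ 2 ^ 24 * N * N ^ 3 := by
      have : D * (α * N / 8 / 2 * θ ^ 2) = α ^ 5 * D * N ^ 3 / 2 ^ 24 := by rw [hθ]; ring
      rw [this] at e2
      have : (2 : ℝ) ^ 24 * N * N ^ 3 = N ^ 4 * 2 ^ 24 := by ring
      rw [this]
      exact (div_le_iff₀ (by positivity)).1 e2
    exact le_of_mul_le_mul_right e3 (by positivity)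
  · rw [Finset.sum_filter]
    have key : ∀ c ∈ I ×ˢ A, ((XX A L c).card : ℝ) ≤
        (if P c then ((XP A L θ c).card : ℝ) else 0) + (α * N / 8 + 64 / (α * N) *
          ∑ y ∈ XX A L c, ((bad A L θ c y).card : ℝ)) := by
      intro c _
      have e1 := bp_pt A L θ c
      have hle : ((XP A L θ c).card : ℝ) ≤ ((XX A L c).card : ℝ) := by
        exact_mod_cast Finset.card_le_card (hsub c)
      have hbp0 : 0 ≤ ∑ y ∈ XX A L c, ((bad A L θ c y).card : ℝ) :=
        Finset.sum_nonneg (fun _ _ => Nat.cast_nonneg _)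
      exact real_pt _ _ _ (α * N) hbp0 (Nat.cast_nonneg _) (Nat.cast_nonneg _) hle e1
        (by positivity)
    have h1 := Finset.sum_le_sum key
    rw [Finset.sum_add_distrib, Finset.sum_add_distrib, ← Finset.mul_sum, Finset.sum_const,
      nsmul_eq_mul, Finset.card_product] at h1
    have h2 := bp_sum I A L θ hθ0.le
    have h3 : 64 / (α * N) * ∑ c ∈ I ×ˢ A, ∑ y ∈ XX A L c, ((bad A L θ c y).card : ℝ) ≤
        64 / (α * N) * (I.card * (A.card : ℝ) ^ 2 * θ) := by gcongr
    have h4 : 64 / (α * N) * (I.card * (A.card : ℝ) ^ 2 * θ) = 1 / 16 * (α * I.card * N ^ 2) := by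
      rw [hθ, ← hN]; field_simp; ring
    push_cast at h1
    rw [← hN] at h1
    have h5 : (I.card : ℝ) * N * (α * N / 8) = 1 / 8 * (α * I.card * N ^ 2) := by ring
    rw [h5] at h1
    linarith


lemma weighted (A : Finset F) (W : F → F → ℝ) (hW : ∀ y z, 0 ≤ W y z) (g g' : F → ℝ) (E : ℝ)
    (hA : 0 < A.card)
    (hg0 : ∀ y, 0 ≤ g y) (hg0' : ∀ y, 0 ≤ g' y)
    (hg : ∀ y ∈ A, g y ≤ ∑ z ∈ A, W y z) (hg' : ∀ z ∈ A, g' z ≤ ∑ y ∈ A, W y z)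
    (hE : ∑ y ∈ A, ∑ z ∈ A, W y z = E) (h1 : 13 / 16 * E ≤ ∑ y ∈ A, g y)
    (h2 : 13 / 16 * E ≤ ∑ z ∈ A, g' z) :
    E / 2 * (E / (20 * A.card)) ^ 2 ≤ ∑ y ∈ A, ∑ z ∈ A, W y z * (g y * g' z) := by
  have hN : 0 < (A.card : ℝ) := by exact_mod_cast hA
  have hE0 : 0 ≤ E := by rw [← hE]; exact Finset.sum_nonneg (fun y _ => Finset.sum_nonneg (fun z _ => hW y z))
  obtain ⟨θ, hθ⟩ : ∃ θ, θ = E / (20 * (A.card : ℝ)) := ⟨_, rfl⟩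
  have hθ0 : 0 ≤ θ := by rw [hθ]; positivity
  have hNθ : A.card * θ = E / 20 := by rw [hθ]; field_simp
  rw [← hθ]
  -- low degree part
  have low : ∀ (d h : F → ℝ), (∀ y ∈ A, h y ≤ d y) → ∑ y ∈ A, d y = E → 13 / 16 * E ≤ ∑ y ∈ A, h y →
      ∑ y ∈ A, (if h y < θ then d y else 0) ≤ E / 4 := by
    intro d h hd hs hh
    have : ∑ y ∈ A, (if h y < θ then d y else 0) ≤ ∑ y ∈ A, ((d y - h y) + θ) := by
      apply Finset.sum_le_sum
      intro y hy
      have := hd y hy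
      split_ifs with hc
      · linarith
      · linarith
    rw [Finset.sum_add_distrib, Finset.sum_sub_distrib, Finset.sum_const, nsmul_eq_mul, hNθ, hs]
      at this
    linarith
  have l1 := low (fun y => ∑ z ∈ A, W y z) g hg hE h1
  have l2 := low (fun z => ∑ y ∈ A, W y z) g' hg' (by rw [Finset.sum_comm]; exact hE) h2
  have l1' : ∑ y ∈ A, ∑ z ∈ A, (if g y < θ then W y z else 0) ≤ E / 4 := by
    refine le_trans (le_of_eq ?_) l1
    apply Finset.sum_congr rfl
    intro y _
    split_ifs <;> simp
  have l2' : ∑ y ∈ A, ∑ z ∈ A, (if g' z < θ then W y z else 0) ≤ E / 4 := by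
    rw [Finset.sum_comm]
    refine le_trans (le_of_eq ?_) l2
    apply Finset.sum_congr rfl
    intro y _
    split_ifs <;> simp
  have key : ∑ y ∈ A, ∑ z ∈ A, θ ^ 2 * (W y z - (if g y < θ then W y z else 0) -
      (if g' z < θ then W y z else 0)) ≤ ∑ y ∈ A, ∑ z ∈ A, W y z * (g y * g' z) := by
    apply Finset.sum_le_sum
    intro y _
    apply Finset.sum_le_sum
    intro z _
    have w := hW y z
    have a := hg0 y
    have b := hg0' z
    have hp : 0 ≤ W y z * (g y * g' z) := by positivity
    have hq : 0 ≤ θ ^ 2 * W y z := by positivity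
    split_ifs with c1 c2 c2
    · nlinarith
    · nlinarith
    · nlinarith
    · have : θ * θ ≤ g y * g' z := mul_le_mul (not_lt.1 c1) (not_lt.1 c2) hθ0 a
      have := mul_le_mul_of_nonneg_left this w
      linarith
  simp only [← Finset.mul_sum, Finset.sum_sub_distrib] at key
  rw [hE] at key
  refine le_trans ?_ key
  rw [mul_comm]
  apply mul_le_mul_of_nonneg_left _ (by positivity)
  linarith

lemma card_eq_ind (A X : Finset F) (h : X ⊆ A) :
    (X.card : ℝ) = ∑ y ∈ A, (if y ∈ X then (1 : ℝ) else 0) := by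
  rw [← Finset.sum_filter, Finset.sum_const, nsmul_eq_mul, mul_one]
  congr 2
  ext y
  simp only [Finset.mem_filter]
  exact ⟨fun hy => ⟨h hy, hy⟩, fun hy => hy.2⟩

lemma side (I A : Finset F) (L : F → F → F → Prop) (Ch : Finset (F × F))
    (Xp : F × F → Finset F) (hCh : Ch ⊆ I ×ˢ A) (hX : ∀ c ∈ Ch, Xp c ⊆ XX A L c) :
    (∀ y ∈ A, ∑ c ∈ Ch, (if y ∈ Xp c then (1 : ℝ) else 0) ≤
      ∑ z ∈ A, ∑ b ∈ I, (if L b y z then (1 : ℝ) else 0)) ∧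
    ∑ y ∈ A, ∑ c ∈ Ch, (if y ∈ Xp c then (1 : ℝ) else 0) = ∑ c ∈ Ch, ((Xp c).card : ℝ) ∧
    ∑ y ∈ A, ∑ z ∈ A, ∑ b ∈ I, (if L b y z then (1 : ℝ) else 0) =
      ∑ c ∈ I ×ˢ A, ((XX A L c).card : ℝ) := by
  refine ⟨?_, ?_, ?_⟩
  · intro y _
    rw [Finset.sum_comm, ← Finset.sum_product (f := fun c : F × F => if L c.1 y c.2 then (1 : ℝ) else 0)]
    calc ∑ c ∈ Ch, (if y ∈ Xp c then (1 : ℝ) else 0)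
        ≤ ∑ c ∈ Ch, (if L c.1 y c.2 then (1 : ℝ) else 0) := by
          apply Finset.sum_le_sum
          intro c hc
          by_cases hy : y ∈ Xp c
          · have := (Finset.mem_filter.1 (hX c hc hy)).2
            simp [hy, this]
          · rw [if_neg hy]; split_ifs <;> norm_num
      _ ≤ _ := by
          apply Finset.sum_le_sum_of_subset_of_nonneg hCh
          intros; split_ifs <;> norm_num
  · rw [Finset.sum_comm]
    apply Finset.sum_congr rfl
    intro c hc
    exact (card_eq_ind A _ ((hX c hc).trans (Finset.filter_subset _ _))).symm
  · have : ∀ c ∈ I ×ˢ A, ((XX A L c).card : ℝ) = ∑ y ∈ A, (if L c.1 y c.2 then (1 : ℝ) else 0) := by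
      intro c _
      unfold XX
      rw [Finset.card_filter]; push_cast; rfl
    rw [Finset.sum_congr rfl this, Finset.sum_comm (s := I ×ˢ A)]
    apply Finset.sum_congr rfl
    intro y _
    rw [Finset.sum_comm, ← Finset.sum_product (f := fun c : F × F => if L c.1 y c.2 then (1 : ℝ) else 0)]

lemma lemma2 (I A : Finset F) (L : F → F → F → Prop) (α E : ℝ) (hα : 0 < α) (hA : 0 < A.card)
    (hI : 0 < I.card)
    (hE : ∑ c ∈ I ×ˢ A, ((XX A L c).card : ℝ) = E)
    (hEα : α * I.card * (A.card : ℝ) ^ 2 ≤ E)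
    (Ch Ch' : Finset (F × F)) (Xp Zp : F × F → Finset F) (hCh : Ch ⊆ I ×ˢ A) (hCh' : Ch' ⊆ I ×ˢ A)
    (hX : ∀ c ∈ Ch, Xp c ⊆ XX A L c) (hZ : ∀ c ∈ Ch', Zp c ⊆ XX A (fun b v w => L b w v) c)
    (sX : 13 / 16 * E ≤ ∑ c ∈ Ch, ((Xp c).card : ℝ))
    (sZ : 13 / 16 * E ≤ ∑ c ∈ Ch', ((Zp c).card : ℝ)) :
    ∃ c ∈ Ch, ∃ c' ∈ Ch', α / 1600 * I.card * ((Xp c).card * (Zp c').card) <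
      ∑ b ∈ I, (((Xp c) ×ˢ (Zp c')).filter (fun p => L b p.1 p.2)).card := by
  obtain ⟨x1, x2, x3⟩ := side I A L Ch Xp hCh hX
  obtain ⟨z1, z2, z3⟩ := side I A (fun b v w => L b w v) Ch' Zp hCh' hZ
  have hN : 0 < (A.card : ℝ) := by exact_mod_cast hA
  have hI' : 0 < (I.card : ℝ) := by exact_mod_cast hI
  have hE0 : 0 < E := lt_of_lt_of_le (by positivity) hEα
  rw [hE] at x3
  have hle : ∀ (A : Finset F) (h d : F → ℝ), (∀ y ∈ A, h y ≤ d y) → ∑ y ∈ A, h y ≤ ∑ y ∈ A, d y :=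
    fun A h d hh => Finset.sum_le_sum hh
  have xE : ∑ c ∈ Ch, ((Xp c).card : ℝ) ≤ E := by
    rw [← x2, ← x3]; exact Finset.sum_le_sum x1
  have zE : ∑ c ∈ Ch', ((Zp c).card : ℝ) ≤ E := by
    rw [← z2, ← x3, Finset.sum_comm (s := A) (t := A)]; exact Finset.sum_le_sum z1
  have w := weighted A (fun y z => ∑ b ∈ I, (if L b y z then (1 : ℝ) else 0))
    (fun y z => Finset.sum_nonneg (fun b _ => by split_ifs <;> norm_num))
    (fun y => ∑ c ∈ Ch, (if y ∈ Xp c then (1 : ℝ) else 0))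
    (fun y => ∑ c ∈ Ch', (if y ∈ Zp c then (1 : ℝ) else 0)) E hA
    (fun y => Finset.sum_nonneg (fun b _ => by split_ifs <;> norm_num))
    (fun y => Finset.sum_nonneg (fun b _ => by split_ifs <;> norm_num))
    x1 z1 x3 (by rw [x2]; exact sX) (by rw [z2]; exact sZ)
  by_contra hcon
  push Not at hcon
  -- rewrite the weighted sum
  have e1 : ∀ c ∈ Ch, ∀ c' ∈ Ch', ∑ y ∈ A, ∑ z ∈ A, ∑ b ∈ I, ((if L b y z then (1 : ℝ) else 0) *
      ((if y ∈ Xp c then (1 : ℝ) else 0) * (if z ∈ Zp c' then (1 : ℝ) else 0))) ≤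
      α / 1600 * I.card * ((Xp c).card * (Zp c').card) := by
    intro c hc c' hc'
    have := hcon c hc c' hc'
    push_cast at this
    refine le_trans (le_of_eq ?_) this
    have hr : ∀ b ∈ I, ((((Xp c) ×ˢ (Zp c')).filter (fun p => L b p.1 p.2)).card : ℝ) =
        ∑ y ∈ A, ∑ z ∈ A, ((if L b y z then (1 : ℝ) else 0) *
      ((if y ∈ Xp c then (1 : ℝ) else 0) * (if z ∈ Zp c' then (1 : ℝ) else 0))) := by
      intro b _
      rw [← Finset.sum_product (f := fun p : F × F => ((if L b p.1 p.2 then (1 : ℝ) else 0) *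
      ((if p.1 ∈ Xp c then (1 : ℝ) else 0) * (if p.2 ∈ Zp c' then (1 : ℝ) else 0))))]
      have : ∀ p ∈ A ×ˢ A, ((if L b p.1 p.2 then (1 : ℝ) else 0) *
        ((if p.1 ∈ Xp c then (1 : ℝ) else 0) * (if p.2 ∈ Zp c' then (1 : ℝ) else 0))) =
        if (L b p.1 p.2 ∧ p.1 ∈ Xp c ∧ p.2 ∈ Zp c') then 1 else 0 := by
        intro p _
        by_cases q1 : L b p.1 p.2 <;> by_cases q2 : p.1 ∈ Xp c <;> by_cases q3 : p.2 ∈ Zp c' <;>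
          simp [q1, q2, q3]
      rw [Finset.sum_congr rfl this, ← Finset.sum_filter, Finset.sum_const, nsmul_eq_mul, mul_one]
      congr 2
      ext p
      simp only [Finset.mem_filter, Finset.mem_product]
      constructor
      · rintro ⟨⟨h1, h2⟩, h3⟩
        exact ⟨⟨(Finset.mem_filter.1 (hX c hc h1)).1, (Finset.mem_filter.1 (hZ c' hc' h2)).1⟩,
          h3, h1, h2⟩
      · rintro ⟨_, h3, h1, h2⟩
        exact ⟨⟨h1, h2⟩, h3⟩
    rw [Finset.sum_congr rfl hr, Finset.sum_comm (s := I)]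
    apply Finset.sum_congr rfl
    intro y _
    rw [Finset.sum_comm (s := I)]
  have e2 : ∑ y ∈ A, ∑ z ∈ A, (∑ b ∈ I, (if L b y z then (1 : ℝ) else 0)) *
      ((∑ c ∈ Ch, (if y ∈ Xp c then (1 : ℝ) else 0)) *
       (∑ c ∈ Ch', (if z ∈ Zp c then (1 : ℝ) else 0))) =
      ∑ c ∈ Ch, ∑ c' ∈ Ch', ∑ y ∈ A, ∑ z ∈ A, ∑ b ∈ I, ((if L b y z then (1 : ℝ) else 0) *
      ((if y ∈ Xp c then (1 : ℝ) else 0) * (if z ∈ Zp c' then (1 : ℝ) else 0))) := by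
    have t1 : ∀ y z, (∑ b ∈ I, (if L b y z then (1 : ℝ) else 0)) *
      ((∑ c ∈ Ch, (if y ∈ Xp c then (1 : ℝ) else 0)) *
       (∑ c ∈ Ch', (if z ∈ Zp c then (1 : ℝ) else 0))) =
      ∑ c ∈ Ch, ∑ c' ∈ Ch', ∑ b ∈ I, ((if L b y z then (1 : ℝ) else 0) *
      ((if y ∈ Xp c then (1 : ℝ) else 0) * (if z ∈ Zp c' then (1 : ℝ) else 0))) := by
      intro y z
      rw [Finset.sum_mul_sum, Finset.mul_sum]
      apply Finset.sum_congr rfl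
      intro c _
      rw [Finset.mul_sum]
      apply Finset.sum_congr rfl
      intro c' _
      rw [Finset.sum_mul]
    calc _ = ∑ y ∈ A, ∑ z ∈ A, ∑ c ∈ Ch, ∑ c' ∈ Ch', ∑ b ∈ I, ((if L b y z then (1 : ℝ) else 0) *
          ((if y ∈ Xp c then (1 : ℝ) else 0) * (if z ∈ Zp c' then (1 : ℝ) else 0))) := by
          apply Finset.sum_congr rfl; intro y _
          apply Finset.sum_congr rfl; intro z _
          exact t1 y z
      _ = ∑ y ∈ A, ∑ c ∈ Ch, ∑ c' ∈ Ch', ∑ z ∈ A, ∑ b ∈ I, ((if L b y z then (1 : ℝ) else 0) *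
          ((if y ∈ Xp c then (1 : ℝ) else 0) * (if z ∈ Zp c' then (1 : ℝ) else 0))) := by
          apply Finset.sum_congr rfl; intro y _
          rw [Finset.sum_comm]
          apply Finset.sum_congr rfl; intro c _
          rw [Finset.sum_comm]
      _ = _ := by
          rw [Finset.sum_comm]
          apply Finset.sum_congr rfl; intro c _
          rw [Finset.sum_comm]
  rw [e2] at w
  have e3 : ∑ c ∈ Ch, ∑ c' ∈ Ch', ∑ y ∈ A, ∑ z ∈ A, ∑ b ∈ I, ((if L b y z then (1 : ℝ) else 0) *
      ((if y ∈ Xp c then (1 : ℝ) else 0) * (if z ∈ Zp c' then (1 : ℝ) else 0))) ≤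
      ∑ c ∈ Ch, ∑ c' ∈ Ch', α / 1600 * I.card * ((Xp c).card * (Zp c').card : ℝ) :=
    Finset.sum_le_sum (fun c hc => Finset.sum_le_sum (fun c' hc' => e1 c hc c' hc'))
  have e4 := w.trans e3
  simp only [← Finset.mul_sum, ← Finset.sum_mul] at e4
  have e5 : (∑ c ∈ Ch, ((Xp c).card : ℝ)) * ∑ c' ∈ Ch', ((Zp c').card : ℝ) ≤ E * E :=
    mul_le_mul xE zE (Finset.sum_nonneg (fun _ _ => Nat.cast_nonneg _)) hE0.le
  have e6 : E / 2 * (E / (20 * A.card)) ^ 2 ≤ α / 1600 * I.card * (E * E) :=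
    e4.trans (mul_le_mul_of_nonneg_left e5 (by positivity))
  have e7 : E / 2 * (E / (20 * A.card)) ^ 2 = E * (E * E) / (800 * (A.card : ℝ) ^ 2) := by
    field_simp; norm_num
  rw [e7, div_le_iff₀ (by positivity)] at e6
  have e8 : E * (E * E) ≤ (α * I.card * (A.card : ℝ) ^ 2 / 2) * (E * E) := by
    refine e6.trans (le_of_eq ?_); ring
  have e9 := le_of_mul_le_mul_right e8 (by positivity)
  linarith


/-- The incidence relation. -/
def LL (A : Finset F) (b y z : F) : Prop := ∃ x ∈ A, x ≠ y ∧ z = (1 - b) * x + b * y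

lemma pick_t (X Z S : Finset F) (L : F → F → Prop) (b : F) (N M : ℝ) (hS : (S.card : ℝ) ≤ N)
    (hM : 0 ≤ M)
    (hL : ∀ y ∈ X, ∀ z ∈ Z, L y z → z - b * y ∈ S)
    (h : N * M < (((X ×ˢ Z).filter (fun p => L p.1 p.2)).card : ℝ)) :
    ∃ t, M ≤ ((X.filter (fun y => b * y + t ∈ Z)).card : ℝ) := by
  by_contra hcon
  push Not at hcon
  have e1 : ((X ×ˢ Z).filter (fun p => L p.1 p.2)).card =
      ∑ t ∈ S, (((X ×ˢ Z).filter (fun p => L p.1 p.2)).filter (fun p => p.2 - b * p.1 = t)).card := by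
    apply Finset.card_eq_sum_card_fiberwise
    intro p hp
    obtain ⟨h1, h2⟩ := Finset.mem_filter.1 (Finset.mem_coe.1 hp)
    obtain ⟨h1, h3⟩ := Finset.mem_product.1 h1
    exact Finset.mem_coe.2 (hL _ h1 _ h3 h2)
  have e2 : ∀ t ∈ S, ((((X ×ˢ Z).filter (fun p => L p.1 p.2)).filter
      (fun p => p.2 - b * p.1 = t)).card : ℝ) ≤ M := by
    intro t _
    refine le_trans ?_ (hcon t).le
    have : (((X ×ˢ Z).filter (fun p => L p.1 p.2)).filter
      (fun p => p.2 - b * p.1 = t)).card ≤ (X.filter (fun y => b * y + t ∈ Z)).card := by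
      apply Finset.card_le_card_of_injOn (fun p => p.1)
      · intro p hp
        obtain ⟨h1, h2⟩ := Finset.mem_filter.1 (Finset.mem_coe.1 hp)
        obtain ⟨h1, h3⟩ := Finset.mem_filter.1 h1
        obtain ⟨h1, h4⟩ := Finset.mem_product.1 h1
        refine Finset.mem_coe.2 (Finset.mem_filter.2 ⟨h1, ?_⟩)
        rw [← h2]; simpa using h4
      · intro p hp p' hp' he
        obtain ⟨_, h2⟩ := Finset.mem_filter.1 (Finset.mem_coe.1 hp)
        obtain ⟨_, h2'⟩ := Finset.mem_filter.1 (Finset.mem_coe.1 hp')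
        have he' : p.1 = p'.1 := he
        refine Prod.ext he' ?_
        rw [he'] at h2
        linear_combination h2 - h2'
    exact_mod_cast this
  have e3 := Finset.sum_le_card_nsmul _ _ _ e2
  have e4 : (((X ×ˢ Z).filter (fun p => L p.1 p.2)).card : ℝ) ≤ S.card * M := by
    rw [e1]; push_cast; rw [← nsmul_eq_mul]; exact e3
  have e5 : S.card * M ≤ N * M := by gcongr
  linarith

lemma pick_xy (A X Z B : Finset F) (M : ℝ)
    (hB1 : ∀ b ∈ B, b ≠ 1)
    (h : (A.card : ℝ) * X.card * M <
      ∑ b ∈ B, (((X ×ˢ Z).filter (fun p => LL A b p.1 p.2)).card : ℝ)) (hM : 0 ≤ M) :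
    ∃ x y, x ≠ y ∧ M ≤ ((B.filter (fun b => (y - x) * b + x ∈ Z)).card : ℝ) := by
  by_contra hcon
  push Not at hcon
  have e1 : ∀ b ∈ B, (((X ×ˢ Z).filter (fun p => LL A b p.1 p.2)).card : ℝ) ≤
      ∑ p ∈ A ×ˢ X, (if p.1 ≠ p.2 ∧ (p.2 - p.1) * b + p.1 ∈ Z then (1 : ℝ) else 0) := by
    intro b hb
    have hb1 : 1 - b ≠ 0 := sub_ne_zero.2 (Ne.symm (hB1 b hb))
    rw [← Finset.sum_filter, Finset.sum_const, nsmul_eq_mul, mul_one]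
    have : ((X ×ˢ Z).filter (fun p => LL A b p.1 p.2)).card ≤
        ((A ×ˢ X).filter (fun p => p.1 ≠ p.2 ∧ (p.2 - p.1) * b + p.1 ∈ Z)).card := by
      apply Finset.card_le_card_of_injOn (fun p => ((p.2 - b * p.1) / (1 - b), p.1))
      · intro p hp
        obtain ⟨h1, x, hx, hxy, hz⟩ := Finset.mem_filter.1 (Finset.mem_coe.1 hp)
        obtain ⟨h1, h3⟩ := Finset.mem_product.1 h1
        have : (p.2 - b * p.1) / (1 - b) = x := by
          rw [hz]; field_simp; ring
        apply Finset.mem_coe.2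
        simp only [this]
        refine Finset.mem_filter.2 ⟨Finset.mem_product.2 ⟨hx, h1⟩, hxy, ?_⟩
        have e : (p.1 - x) * b + x = p.2 := by rw [hz]; ring
        simp only [e]
        exact h3
      · intro p _ p' _ he
        simp only [Prod.mk.injEq] at he
        obtain ⟨h1, h2⟩ := he
        refine Prod.ext h2 ?_
        rw [h2] at h1
        have h4 := (div_left_inj' hb1).1 h1
        linear_combination h4
    exact_mod_cast this
  have e2 := Finset.sum_le_sum e1
  rw [Finset.sum_comm] at e2
  have e3 : ∀ p ∈ A ×ˢ X, ∑ b ∈ B,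
      (if p.1 ≠ p.2 ∧ (p.2 - p.1) * b + p.1 ∈ Z then (1 : ℝ) else 0) ≤ M := by
    intro p _
    by_cases hp : p.1 = p.2
    · simpa [hp] using hM
    · have := (hcon p.1 p.2 hp).le
      rw [Finset.card_filter] at this
      push_cast at this
      simpa [hp] using this
  have e4 := Finset.sum_le_card_nsmul _ _ _ e3
  rw [nsmul_eq_mul, Finset.card_product] at e4
  push_cast at e4
  linarith

lemma E_swap (I A : Finset F) (L : F → F → F → Prop) :
    ∑ c ∈ I ×ˢ A, ((XX A (fun b v w => L b w v) c).card : ℝ) =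
    ∑ c ∈ I ×ˢ A, ((XX A L c).card : ℝ) := by
  obtain ⟨_, _, x3⟩ := side I A L ∅ (fun _ => ∅) (by simp) (by simp)
  obtain ⟨_, _, z3⟩ := side I A (fun b v w => L b w v) ∅ (fun _ => ∅) (by simp) (by simp)
  rw [← x3, ← z3, Finset.sum_comm]

lemma lemma3 (I A : Finset F) (α β : ℝ) (hα : 0 < α) (hα1 : α ≤ 1) (hβ : β = α / 2048)
    (hA : 0 < A.card) (hI0 : ∀ b ∈ I, b ≠ 0) (hI1 : ∀ b ∈ I, b ≠ 1)
    (hI : α * A.card ≤ (I.card : ℝ))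
    (hb : ∀ b ∈ I, α * (A.card : ℝ) ^ 2 ≤
      (((A ×ˢ A).filter (fun p => LL A b p.1 p.2)).card : ℝ)) :
    ∃ (X Z B Q0 : Finset F) (ξ ζ : F), Conf β (A.card : ℝ) X Z B ∧ B ⊆ I ∧
      β ^ 2 * (A.card : ℝ) ≤ (B.card : ℝ) ∧ Q0 ⊆ B ∧ β ^ 4 * (A.card : ℝ) ≤ (Q0.card : ℝ) ∧
      ξ ≠ 0 ∧ ∀ b ∈ Q0, ξ * b + ζ ∈ Z := by
  obtain ⟨N, hN⟩ : ∃ N : ℝ, N = (A.card : ℝ) := ⟨_, rfl⟩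
  have hN0 : 0 < N := by rw [hN]; exact_mod_cast hA
  have hβ0 : 0 < β := by rw [hβ]; positivity
  obtain ⟨E, hE⟩ : ∃ E, ∑ c ∈ I ×ˢ A, ((XX A (LL A) c).card : ℝ) = E := ⟨_, rfl⟩
  have hEα : α * I.card * (A.card : ℝ) ^ 2 ≤ E := by
    obtain ⟨_, _, x3⟩ := side I A (LL A) ∅ (fun _ => ∅) (by simp) (by simp)
    rw [← hE, ← x3]
    have e1 : ∀ b ∈ I, α * (A.card : ℝ) ^ 2 ≤ ∑ y ∈ A, ∑ z ∈ A,
        (if LL A b y z then (1 : ℝ) else 0) := by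
      intro b hbI
      refine (hb b hbI).trans (le_of_eq ?_)
      rw [Finset.card_filter, Finset.sum_product]
      push_cast
      rfl
    have e2 := Finset.card_nsmul_le_sum _ _ _ e1
    rw [nsmul_eq_mul] at e2
    calc α * I.card * (A.card : ℝ) ^ 2 = I.card * (α * (A.card : ℝ) ^ 2) := by ring
      _ ≤ _ := e2
      _ = _ := by
        rw [Finset.sum_comm]
        apply Finset.sum_congr rfl
        intro y _
        rw [Finset.sum_comm]
  have hSc : ∀ b ∈ I, (A.image (fun x => (1 - b) * x)).card ≤ A.card :=
    fun b _ => Finset.card_image_le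
  have hEα' : α * I.card * (A.card : ℝ) ^ 2 ≤
      ∑ c ∈ I ×ˢ A, ((XX A (fun b v w => LL A b w v) c).card : ℝ) := by
    rw [E_swap, hE]; exact hEα
  have hSmem : ∀ b y z, LL A b y z → z - b * y ∈ A.image (fun x => (1 - b) * x) := by
    rintro b y z ⟨x, hx, _, rfl⟩
    exact Finset.mem_image.2 ⟨x, hx, by ring⟩
  obtain ⟨Ch, Xp, c1, c2, c3, c4, c5⟩ := lemma1 I A (LL A) (fun b => -b) (fun _ => 1)
    (fun b => A.image (fun x => (1 - b) * x)) α hα hA (fun b hb => neg_ne_zero.2 (hI0 b hb))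
    (fun b _ => one_ne_zero) hSc (by
      intro b _ v _ w _ h
      have := hSmem _ _ _ h
      convert this using 1
      ring) (by rw [hE]; exact hEα)
  obtain ⟨Ch', Zp, d1, d2, d3, d4, d5⟩ := lemma1 I A (fun b v w => LL A b w v) (fun _ => 1)
    (fun b => -b)
    (fun b => A.image (fun x => (1 - b) * x)) α hα hA (fun b _ => one_ne_zero)
    (fun b hb => neg_ne_zero.2 (hI0 b hb)) hSc (by
      intro b _ v _ w _ h
      have := hSmem _ _ _ h
      convert this using 1
      ring) hEα'
  rw [hE] at c5
  rw [E_swap, hE] at d5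
  have hIc : 0 < (I.card : ℝ) := lt_of_lt_of_le (by positivity) hI
  obtain ⟨c, hc, c', hc', hlt⟩ := lemma2 I A (LL A) α E hα hA (by exact_mod_cast hIc) hE hEα
    Ch Ch' Xp Zp c1 d1 c2 d2 c5 d5
  have cX := c3 c hc
  have dX := c4 c hc
  have cZ := d3 c' hc'
  have dZ := d4 c' hc'
  obtain ⟨X, hX⟩ : ∃ X, X = Xp c := ⟨_, rfl⟩
  obtain ⟨Z, hZ⟩ : ∃ Z, Z = Zp c' := ⟨_, rfl⟩
  rw [← hX] at cX dX hlt
  rw [← hZ] at cZ dZ hlt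
  push_cast at hlt
  rw [← hN] at cX dX cZ dZ hI ⊢
  have hx0 : 0 < (X.card : ℝ) := lt_of_lt_of_le (by positivity) cX
  have hz0 : 0 < (Z.card : ℝ) := lt_of_lt_of_le (by positivity) cZ
  set n : F → ℝ := fun b => (((X ×ˢ Z).filter (fun p => LL A b p.1 p.2)).card : ℝ) with hn
  set B := I.filter (fun b => α / 3200 * (X.card * Z.card) ≤ n b) with hB
  have hn1 : ∀ b, n b ≤ X.card * Z.card := by
    intro b
    have : ((X ×ˢ Z).filter (fun p => LL A b p.1 p.2)).card ≤ X.card * Z.card := by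
      rw [← Finset.card_product]; exact Finset.card_filter_le _ _
    simp only [hn]
    exact_mod_cast this
  have hBc : α / 3200 * I.card ≤ (B.card : ℝ) := by
    have e1 : ∑ b ∈ I, n b ≤ ∑ b ∈ I, ((if α / 3200 * (X.card * Z.card) ≤ n b then
        ((X.card : ℝ) * Z.card) else 0) + α / 3200 * (X.card * Z.card)) := by
      apply Finset.sum_le_sum
      intro b _
      split_ifs with h
      · have := hn1 b
        have : 0 ≤ α / 3200 * (X.card * Z.card : ℝ) := by positivity
        linarith [hn1 b]
      · linarith
    rw [Finset.sum_add_distrib, ← Finset.sum_filter, Finset.sum_const, Finset.sum_const,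
      nsmul_eq_mul, nsmul_eq_mul, ← hB] at e1
    have e2 : (α / 3200 * I.card) * (X.card * Z.card : ℝ) ≤ B.card * (X.card * Z.card) := by
      linarith
    exact le_of_mul_le_mul_right e2 (by positivity)
  have hBN : α / 3200 * (α * N) ≤ (B.card : ℝ) :=
    le_trans (by gcongr) hBc
  have hxz : α * N / 16 * (α * N / 16) ≤ (X.card : ℝ) * Z.card := by gcongr
  obtain ⟨x, y, hxy, hQ⟩ := pick_xy A X Z B (β ^ 4 * N)
    (fun b hb => hI1 b (Finset.mem_filter.1 hb).1) (by
      have e1 : ∀ b ∈ B, α / 3200 * (X.card * Z.card : ℝ) ≤ n b :=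
        fun b hb => (Finset.mem_filter.1 hb).2
      have e2 := Finset.card_nsmul_le_sum _ _ _ e1
      rw [nsmul_eq_mul] at e2
      refine lt_of_lt_of_le ?_ e2
      calc (A.card : ℝ) * X.card * (β ^ 4 * N) = (N * (β ^ 4 * N)) * X.card := by rw [← hN]; ring
        _ < (α / 3200 * (α * N) * (α / 3200 * (α * N / 16))) * X.card := by
          apply mul_lt_mul_of_pos_right _ hx0
          rw [hβ]
          have : 0 < α ^ 4 * N ^ 2 := by positivity
          ring_nf
          linarith
        _ ≤ (B.card * (α / 3200 * Z.card)) * X.card := by gcongr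
        _ = _ := by ring) (by positivity)
  refine ⟨X, Z, B, _, y - x, x, ?_, Finset.filter_subset _ _, ?_,
    Finset.filter_subset _ _, hQ, sub_ne_zero.2 (Ne.symm hxy), ?_⟩
  · refine ⟨hβ0, ?_, hN0, ?_, ?_, ?_, ?_⟩
    · rw [hβ]; linarith
    · refine le_trans ?_ cZ
      rw [hβ]
      have : 0 < α * N := by positivity
      linarith
    · rw [hβ, div_pow, div_mul_eq_mul_div, div_le_iff₀ (by positivity)]
      refine dX.trans ?_
      rw [mul_comm]
      gcongr
      norm_num
    · rw [hβ, div_pow, div_mul_eq_mul_div, div_le_iff₀ (by positivity)]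
      refine dZ.trans ?_
      rw [mul_comm]
      gcongr
      norm_num
    · intro b hbB
      obtain ⟨hbI, hbn⟩ := Finset.mem_filter.1 hbB
      refine ⟨hI0 b hbI, ?_⟩
      apply pick_t X Z (A.image (fun x => (1 - b) * x)) (LL A b) b N (β ^ 3 * N)
      · rw [hN]; exact_mod_cast hSc b hbI
      · positivity
      · intro y _ z _ h; exact hSmem _ _ _ h
      · refine lt_of_lt_of_le ?_ hbn
        calc N * (β ^ 3 * N) < α / 3200 * (α * N / 16 * (α * N / 16)) := by
              rw [hβ]
              have : 0 < α ^ 3 * N ^ 2 := by positivity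
              ring_nf
              linarith
          _ ≤ _ := by gcongr
  · refine le_trans ?_ hBN
    rw [hβ]
    have : 0 < α ^ 2 * N := by positivity
    ring_nf
    linarith
  · intro b hb
    exact (Finset.mem_filter.1 hb).2


/-- Triples with a given ratio. -/
def tt (A : Finset F) (ρ : F) : ℕ :=
  ((A ×ˢ A ×ˢ A).filter (fun b => b.2.2 ≠ b.1 ∧ b.2.1 - b.1 = ρ * (b.2.2 - b.1))).card

lemma tt_le (A : Finset F) (ρ : F) :
    tt A ρ ≤ ((A ×ˢ A).filter (fun p => LL A ρ p.1 p.2)).card ∨ ρ = 1 := by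
  by_cases h1 : ρ = 1
  · exact Or.inr h1
  left
  have h1' : 1 - ρ ≠ 0 := sub_ne_zero.2 (Ne.symm h1)
  apply Finset.card_le_card_of_injOn (fun b => (b.2.2, b.2.1))
  · rintro ⟨b1, b2, b3⟩ hb
    obtain ⟨h, h2, h3⟩ := Finset.mem_filter.1 (Finset.mem_coe.1 hb)
    simp only [Finset.mem_product] at h h2 h3
    refine Finset.mem_coe.2 (Finset.mem_filter.2 ⟨Finset.mem_product.2 ⟨h.2.2, h.2.1⟩, ?_⟩)
    exact ⟨b1, h.1, Ne.symm h2, by linear_combination h3⟩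
  · rintro ⟨b1, b2, b3⟩ hb ⟨c1, c2, c3⟩ hc he
    obtain ⟨_, _, h3⟩ := Finset.mem_filter.1 (Finset.mem_coe.1 hb)
    obtain ⟨_, _, h3'⟩ := Finset.mem_filter.1 (Finset.mem_coe.1 hc)
    simp only [Prod.mk.injEq] at he h3 h3' ⊢
    obtain ⟨rfl, rfl⟩ := he
    refine ⟨?_, rfl, rfl⟩
    apply mul_left_cancel₀ h1'
    linear_combination -h3 + h3'

/-- All sextuples. -/
def Sx (A : Finset F) : Finset ((F × F × F) × (F × F × F)) := (A ×ˢ A ×ˢ A) ×ˢ (A ×ˢ A ×ˢ A)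

lemma deg_card (A : Finset F) (P : (F × F × F) × (F × F × F) → Prop)
    (f : (F × F × F) × (F × F × F) → (F × F) × (F × F))
    (hf : ∀ x ∈ Sx A, f x ∈ (A ×ˢ A) ×ˢ (A ×ˢ A))
    (hi : ∀ x y, P x → P y → f x = f y → x = y) :
    ((Sx A).filter P).card ≤ A.card ^ 4 := by
  have : A.card ^ 4 = ((A ×ˢ A) ×ˢ (A ×ˢ A)).card := by
    simp only [Finset.card_product]; ring
  rw [this]
  apply Finset.card_le_card_of_injOn f
  · intro x hx
    exact Finset.mem_coe.2 (hf x (Finset.mem_filter.1 (Finset.mem_coe.1 hx)).1)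
  · intro x hx y hy he
    exact hi x y (Finset.mem_filter.1 (Finset.mem_coe.1 hx)).2
      (Finset.mem_filter.1 (Finset.mem_coe.1 hy)).2 he

/-- ratio of a triple -/
def rho (a : F × F × F) : F := (a.2.1 - a.1) / (a.2.2 - a.1)


/-- degenerate sextuples -/
def Dg1 (x : (F × F × F) × (F × F × F)) : Prop := x.1.2.2 = x.1.1 ∧ x.1.2.1 = x.1.1
/-- degenerate sextuples -/
def Dg2 (x : (F × F × F) × (F × F × F)) : Prop := x.1.2.2 = x.1.1 ∧ x.2.2.2 = x.2.1
/-- degenerate sextuples -/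
def Dg3 (x : (F × F × F) × (F × F × F)) : Prop := x.2.2.2 = x.2.1 ∧ x.2.2.1 = x.2.1
/-- degenerate sextuples -/
def Dg4 (x : (F × F × F) × (F × F × F)) : Prop := x.1.2.1 = x.1.1 ∧ x.2.2.1 = x.2.1
/-- degenerate sextuples -/
def Dg5 (x : (F × F × F) × (F × F × F)) : Prop := x.1.2.1 = x.1.2.2 ∧ x.2.2.1 = x.2.2.2
/-- low multiplicity sextuples -/
def QLo (A : Finset F) (M : ℝ) (x : (F × F × F) × (F × F × F)) : Prop :=
  (x.2.2.2 ≠ x.2.1 ∧ x.2.2.1 - x.2.1 = rho x.1 * (x.2.2.2 - x.2.1)) ∧ (tt A (rho x.1) : ℝ) < M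
/-- popular ratios -/
def PP (A : Finset F) (M : ℝ) (ρ : F) : Prop := ρ ≠ 0 ∧ ρ ≠ 1 ∧ M ≤ (tt A ρ : ℝ)
/-- high multiplicity sextuples -/
def QHi (A : Finset F) (M : ℝ) (x : (F × F × F) × (F × F × F)) : Prop :=
  (x.1.2.2 ≠ x.1.1 ∧ PP A M (rho x.1)) ∧ x.2.2.1 - x.2.1 = rho x.1 * (x.2.2.2 - x.2.1)

lemma split_six (A : Finset F) (M : ℝ) (x : (F × F × F) × (F × F × F))
    (he : (x.1.2.1 - x.1.1) * (x.2.2.2 - x.2.1) = (x.1.2.2 - x.1.1) * (x.2.2.1 - x.2.1)) :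
    (((((Dg1 x ∨ Dg2 x) ∨ Dg3 x) ∨ Dg4 x) ∨ Dg5 x) ∨ QLo A M x) ∨ QHi A M x := by
  by_cases h1 : x.1.2.2 = x.1.1
  · rw [h1, sub_self, zero_mul, mul_eq_zero, sub_eq_zero, sub_eq_zero] at he
    rcases he with he | he
    · exact Or.inl (Or.inl (Or.inl (Or.inl (Or.inl (Or.inl ⟨h1, he⟩)))))
    · exact Or.inl (Or.inl (Or.inl (Or.inl (Or.inl (Or.inr ⟨h1, he⟩)))))
  by_cases h2 : x.2.2.2 = x.2.1
  · rw [h2, sub_self, mul_zero, eq_comm, mul_eq_zero, sub_eq_zero, sub_eq_zero] at he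
    rcases he with he | he
    · exact absurd he h1
    · exact Or.inl (Or.inl (Or.inl (Or.inl (Or.inr ⟨h2, he⟩))))
  have h1' := sub_ne_zero.2 h1
  have h2' := sub_ne_zero.2 h2
  have hr : x.2.2.1 - x.2.1 = rho x.1 * (x.2.2.2 - x.2.1) := by
    unfold rho
    rw [div_mul_eq_mul_div, eq_div_iff h1']
    linear_combination -he
  by_cases h3 : rho x.1 = 0
  · have e1 : x.2.2.1 = x.2.1 := by
      rw [h3, zero_mul, sub_eq_zero] at hr; exact hr
    have e2 : x.1.2.1 = x.1.1 := by
      unfold rho at h3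
      rw [div_eq_zero_iff, sub_eq_zero] at h3
      rcases h3 with h3 | h3
      · exact h3
      · exact absurd h3 h1'
    exact Or.inl (Or.inl (Or.inl (Or.inr ⟨e2, e1⟩)))
  by_cases h4 : rho x.1 = 1
  · have e1 : x.2.2.1 = x.2.2.2 := by
      rw [h4, one_mul] at hr; linear_combination hr
    have e2 : x.1.2.1 = x.1.2.2 := by
      unfold rho at h4
      rw [div_eq_one_iff_eq h1'] at h4
      linear_combination h4
    exact Or.inl (Or.inl (Or.inr ⟨e2, e1⟩))
  by_cases h5 : (tt A (rho x.1) : ℝ) < M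
  · exact Or.inl (Or.inr ⟨⟨h2, hr⟩, h5⟩)
  · exact Or.inr ⟨⟨h1, h3, h4, not_lt.1 h5⟩, hr⟩

lemma mem_Sx (A : Finset F) (x : (F × F × F) × (F × F × F)) : x ∈ Sx A ↔
    (x.1.1 ∈ A ∧ x.1.2.1 ∈ A ∧ x.1.2.2 ∈ A) ∧ (x.2.1 ∈ A ∧ x.2.2.1 ∈ A ∧ x.2.2.2 ∈ A) := by
  unfold Sx; simp only [Finset.mem_product]

lemma card_Dg1 (A : Finset F) : ((Sx A).filter Dg1).card ≤ A.card ^ 4 := by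
  apply deg_card A Dg1 (fun x => ((x.1.1, x.2.1), (x.2.2.1, x.2.2.2)))
  · intro x hx
    obtain ⟨⟨h1, h2, h3⟩, h4, h5, h6⟩ := (mem_Sx A x).1 hx
    simp only [Finset.mem_product, *, and_self]
  · rintro ⟨⟨a1, a2, a3⟩, b1, b2, b3⟩ ⟨⟨c1, c2, c3⟩, d1, d2, d3⟩ ⟨p1, p2⟩ ⟨q1, q2⟩ he
    simp only [Prod.mk.injEq] at he p1 p2 q1 q2 ⊢
    obtain ⟨⟨r1, r2⟩, r3, r4⟩ := he
    subst r1 r2 r3 r4 p1 p2 q1 q2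
    simp

lemma card_Dg2 (A : Finset F) : ((Sx A).filter Dg2).card ≤ A.card ^ 4 := by
  apply deg_card A Dg2 (fun x => ((x.1.1, x.1.2.1), (x.2.1, x.2.2.1)))
  · intro x hx
    obtain ⟨⟨h1, h2, h3⟩, h4, h5, h6⟩ := (mem_Sx A x).1 hx
    simp only [Finset.mem_product, *, and_self]
  · rintro ⟨⟨a1, a2, a3⟩, b1, b2, b3⟩ ⟨⟨c1, c2, c3⟩, d1, d2, d3⟩ ⟨p1, p2⟩ ⟨q1, q2⟩ he
    simp only [Prod.mk.injEq] at he p1 p2 q1 q2 ⊢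
    obtain ⟨⟨r1, r2⟩, r3, r4⟩ := he
    subst r1 r2 r3 r4 p1 p2 q1 q2
    simp

lemma card_Dg3 (A : Finset F) : ((Sx A).filter Dg3).card ≤ A.card ^ 4 := by
  apply deg_card A Dg3 (fun x => ((x.1.1, x.1.2.1), (x.1.2.2, x.2.1)))
  · intro x hx
    obtain ⟨⟨h1, h2, h3⟩, h4, h5, h6⟩ := (mem_Sx A x).1 hx
    simp only [Finset.mem_product, *, and_self]
  · rintro ⟨⟨a1, a2, a3⟩, b1, b2, b3⟩ ⟨⟨c1, c2, c3⟩, d1, d2, d3⟩ ⟨p1, p2⟩ ⟨q1, q2⟩ he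
    simp only [Prod.mk.injEq] at he p1 p2 q1 q2 ⊢
    obtain ⟨⟨r1, r2⟩, r3, r4⟩ := he
    subst r1 r2 r3 r4 p1 p2 q1 q2
    simp

lemma card_Dg4 (A : Finset F) : ((Sx A).filter Dg4).card ≤ A.card ^ 4 := by
  apply deg_card A Dg4 (fun x => ((x.1.1, x.1.2.2), (x.2.1, x.2.2.2)))
  · intro x hx
    obtain ⟨⟨h1, h2, h3⟩, h4, h5, h6⟩ := (mem_Sx A x).1 hx
    simp only [Finset.mem_product, *, and_self]
  · rintro ⟨⟨a1, a2, a3⟩, b1, b2, b3⟩ ⟨⟨c1, c2, c3⟩, d1, d2, d3⟩ ⟨p1, p2⟩ ⟨q1, q2⟩ he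
    simp only [Prod.mk.injEq] at he p1 p2 q1 q2 ⊢
    obtain ⟨⟨r1, r2⟩, r3, r4⟩ := he
    subst r1 r2 r3 r4 p1 p2 q1 q2
    simp

lemma card_Dg5 (A : Finset F) : ((Sx A).filter Dg5).card ≤ A.card ^ 4 := by
  apply deg_card A Dg5 (fun x => ((x.1.1, x.1.2.1), (x.2.1, x.2.2.1)))
  · intro x hx
    obtain ⟨⟨h1, h2, h3⟩, h4, h5, h6⟩ := (mem_Sx A x).1 hx
    simp only [Finset.mem_product, *, and_self]
  · rintro ⟨⟨a1, a2, a3⟩, b1, b2, b3⟩ ⟨⟨c1, c2, c3⟩, d1, d2, d3⟩ ⟨p1, p2⟩ ⟨q1, q2⟩ he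
    simp only [Prod.mk.injEq] at he p1 p2 q1 q2 ⊢
    obtain ⟨⟨r1, r2⟩, r3, r4⟩ := he
    subst r1 r2 r3 r4 p1 p2 q1 q2
    simp

lemma card_Lo (A : Finset F) (α N : ℝ) (hα : 0 < α) (hNd : N = (A.card : ℝ)) (hN0 : 0 < N) :
    (((Sx A).filter (QLo A (α * N ^ 2))).card : ℝ) ≤ α * N ^ 5 := by
  have e1 : (((Sx A).filter (QLo A (α * N ^ 2))).card : ℝ) = ∑ a ∈ A ×ˢ A ×ˢ A, ∑ b ∈ A ×ˢ A ×ˢ A,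
      (if (b.2.2 ≠ b.1 ∧ b.2.1 - b.1 = rho a * (b.2.2 - b.1)) ∧
        (tt A (rho a) : ℝ) < α * N ^ 2 then (1 : ℝ) else 0) := by
    rw [Finset.card_filter]
    unfold Sx
    rw [Finset.sum_product]
    push_cast
    refine Finset.sum_congr rfl fun a _ => Finset.sum_congr rfl fun b _ => ?_
    unfold QLo
    congr 1
  have e2 : ∀ a ∈ A ×ˢ A ×ˢ A, ∑ b ∈ A ×ˢ A ×ˢ A,
      (if (b.2.2 ≠ b.1 ∧ b.2.1 - b.1 = rho a * (b.2.2 - b.1)) ∧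
        (tt A (rho a) : ℝ) < α * N ^ 2 then (1 : ℝ) else 0) ≤ α * N ^ 2 := by
    intro a _
    by_cases h : (tt A (rho a) : ℝ) < α * N ^ 2
    · simp only [h, and_true]
      refine le_trans (le_of_eq ?_) h.le
      unfold tt
      rw [Finset.card_filter]
      push_cast
      rfl
    · simp only [h, and_false, if_false, Finset.sum_const_zero]
      positivity
  have e3 := Finset.sum_le_card_nsmul _ _ _ e2
  rw [e1]
  refine e3.trans (le_of_eq ?_)
  rw [nsmul_eq_mul, Finset.card_product, Finset.card_product]
  push_cast
  rw [← hNd]; ring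

lemma card_Hi (A : Finset F) (α N : ℝ) (hα : 0 < α) (hNd : N = (A.card : ℝ)) (hN0 : 0 < N)
    (hex : ∀ a1 a3, a3 ≠ a1 → ((A.filter (fun a2 => PP A (α * N ^ 2) (rho (a1, a2, a3)))).card : ℝ) < α * N) :
    (((Sx A).filter (QHi A (α * N ^ 2))).card : ℝ) ≤ α * N ^ 5 := by
  set V := (A ×ˢ A ×ˢ A).filter (fun a => a.2.2 ≠ a.1 ∧ PP A (α * N ^ 2) (rho a)) with hV
  have e1 : ((Sx A).filter (QHi A (α * N ^ 2))).card ≤ (V ×ˢ (A ×ˢ A)).card := by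
    apply Finset.card_le_card_of_injOn (fun x => (x.1, (x.2.1, x.2.2.2)))
    · intro x hx
      obtain ⟨hx1, hx2, hx3⟩ := Finset.mem_filter.1 (Finset.mem_coe.1 hx)
      have hx4 := (mem_Sx A x).1 hx1
      apply Finset.mem_coe.2
      simp only [Finset.mem_product, hV, Finset.mem_filter]
      exact ⟨⟨hx4.1, hx2⟩, hx4.2.1, hx4.2.2.2⟩
    · rintro ⟨a, b1, b2, b3⟩ hx ⟨c, d1, d2, d3⟩ hy he
      obtain ⟨_, _, hx3⟩ := Finset.mem_filter.1 (Finset.mem_coe.1 hx)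
      obtain ⟨_, _, hy3⟩ := Finset.mem_filter.1 (Finset.mem_coe.1 hy)
      simp only [Prod.mk.injEq] at he hx3 hy3 ⊢
      obtain ⟨rfl, rfl, rfl⟩ := he
      refine ⟨rfl, rfl, ?_, rfl⟩
      linear_combination hx3 - hy3
  have e2 : (V.card : ℝ) ≤ α * N ^ 3 := by
    have f1 : (V.card : ℝ) = ∑ a1 ∈ A, ∑ a3 ∈ A, ∑ a2 ∈ A,
        (if a3 ≠ a1 ∧ PP A (α * N ^ 2) (rho (a1, a2, a3)) then (1 : ℝ) else 0) := by
      rw [hV, Finset.card_filter, Finset.sum_product]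
      push_cast
      apply Finset.sum_congr rfl
      intro a1 _
      rw [Finset.sum_product, Finset.sum_comm]
    have f2 : ∀ a1 ∈ A, ∀ a3 ∈ A, ∑ a2 ∈ A,
        (if a3 ≠ a1 ∧ PP A (α * N ^ 2) (rho (a1, a2, a3)) then (1 : ℝ) else 0) ≤ α * N := by
      intro a1 _ a3 _
      by_cases h : a3 = a1
      · simp only [h, ne_eq, not_true_eq_false, false_and, if_false, Finset.sum_const_zero]
        positivity
      · refine le_trans (le_of_eq ?_) (hex a1 a3 h).le
        rw [Finset.card_filter]
        push_cast
        simp only [ne_eq, h, not_false_eq_true, true_and]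
    have f3 : ∀ a1 ∈ A, ∑ a3 ∈ A, ∑ a2 ∈ A,
        (if a3 ≠ a1 ∧ PP A (α * N ^ 2) (rho (a1, a2, a3)) then (1 : ℝ) else 0) ≤ N * (α * N) := by
      intro a1 h1
      have := Finset.sum_le_card_nsmul _ _ _ (f2 a1 h1)
      rw [nsmul_eq_mul, ← hNd] at this
      exact this
    have f4 := Finset.sum_le_card_nsmul _ _ _ f3
    rw [f1]
    refine f4.trans (le_of_eq ?_)
    rw [nsmul_eq_mul, ← hNd]; ring
  have e1' : (((Sx A).filter (QHi A (α * N ^ 2))).card : ℝ) ≤ V.card * (N * N) := by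
    rw [Finset.card_product, Finset.card_product] at e1
    have e1c : (((Sx A).filter (QHi A (α * N ^ 2))).card : ℝ) ≤
        V.card * ((A.card : ℝ) * (A.card : ℝ)) := by exact_mod_cast e1
    rw [← hNd] at e1c
    exact e1c
  calc (((Sx A).filter (QHi A (α * N ^ 2))).card : ℝ) ≤ V.card * (N * N) := e1'
    _ ≤ α * N ^ 3 * (N * N) := by gcongr
    _ = _ := by ring

lemma T_setup (A : Finset F) (α : ℝ) (hα : 0 < α) (hA : 0 < A.card)
    (hN : 6 ≤ α * A.card) (hT : 8 * α * (A.card : ℝ) ^ 5 ≤ (collinearTriples A A : ℝ)) :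
    ∃ (I : Finset F) (a δ : F), δ ≠ 0 ∧ (∀ b ∈ I, b ≠ 0) ∧ (∀ b ∈ I, b ≠ 1) ∧
      α * A.card ≤ (I.card : ℝ) ∧ (∀ b ∈ I, δ * b + a ∈ A) ∧
      ∀ b ∈ I, α * (A.card : ℝ) ^ 2 ≤
        (((A ×ˢ A).filter (fun p => LL A b p.1 p.2)).card : ℝ) := by
  obtain ⟨N, hNd⟩ : ∃ N : ℝ, N = (A.card : ℝ) := ⟨_, rfl⟩
  rw [← hNd] at hN hT ⊢
  have hN0 : 0 < N := by nlinarith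
  by_cases hex : ∃ a1 a3, a3 ≠ a1 ∧ α * N ≤ ((A.filter (fun a2 => PP A (α * N ^ 2) (rho (a1, a2, a3)))).card : ℝ)
  · obtain ⟨a1, a3, h13, hc⟩ := hex
    have h13' : a3 - a1 ≠ 0 := sub_ne_zero.2 h13
    have hmem : ∀ b ∈ (A.filter (fun a2 => PP A (α * N ^ 2) (rho (a1, a2, a3)))).image (fun a2 => rho (a1, a2, a3)),
        ∃ a2 ∈ A, PP A (α * N ^ 2) b ∧ b = rho (a1, a2, a3) := by
      intro b hb
      obtain ⟨a2, ha2, rfl⟩ := Finset.mem_image.1 hb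
      exact ⟨a2, (Finset.mem_filter.1 ha2).1, (Finset.mem_filter.1 ha2).2, rfl⟩
    refine ⟨(A.filter (fun a2 => PP A (α * N ^ 2) (rho (a1, a2, a3)))).image (fun a2 => rho (a1, a2, a3)), a1,
      a3 - a1, h13', ?_, ?_, ?_, ?_, ?_⟩
    · intro b hb
      obtain ⟨a2, _, hp, _⟩ := hmem b hb
      exact hp.1
    · intro b hb
      obtain ⟨a2, _, hp, _⟩ := hmem b hb
      exact hp.2.1
    · rw [Finset.card_image_of_injective]
      · exact hc
      · intro x y hxy
        unfold rho at hxy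
        have := (div_left_inj' h13').1 hxy
        simpa using this
    · intro b hb
      obtain ⟨a2, h2, _, rfl⟩ := hmem b hb
      unfold rho
      convert h2 using 1
      simp only
      field_simp
      ring
    · intro b hb
      obtain ⟨a2, _, hp, _⟩ := hmem b hb
      refine hp.2.2.trans ?_
      rcases tt_le A b with h | h
      · exact_mod_cast h
      · exact absurd h hp.2.1
  · exfalso
    push Not at hex
    have hsub : ((A ×ˢ A ×ˢ A) ×ˢ (A ×ˢ A ×ˢ A)).filter
        (fun x => (x.1.2.1 - x.1.1) * (x.2.2.2 - x.2.1) = (x.1.2.2 - x.1.1) * (x.2.2.1 - x.2.1)) ⊆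
        (((((((Sx A).filter Dg1 ∪ (Sx A).filter Dg2) ∪ (Sx A).filter Dg3) ∪ (Sx A).filter Dg4) ∪
          (Sx A).filter Dg5) ∪ (Sx A).filter (QLo A (α * N ^ 2))) ∪
          (Sx A).filter (QHi A (α * N ^ 2))) := by
      intro x hx
      obtain ⟨hx, he⟩ := Finset.mem_filter.1 hx
      have hx : x ∈ Sx A := hx
      simp only [Finset.mem_union, Finset.mem_filter, hx, true_and]
      exact split_six A (α * N ^ 2) x he
    have c1 := card_Dg1 A
    have c2 := card_Dg2 A
    have c3 := card_Dg3 A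
    have c4 := card_Dg4 A
    have c5 := card_Dg5 A
    have c6 := card_Lo A α N hα hNd hN0
    have c7 := card_Hi A α N hα hNd hN0 hex
    have hc : (collinearTriples A A : ℝ) ≤ 5 * N ^ 4 + 2 * (α * N ^ 5) := by
      have k1 : collinearTriples A A ≤
          ((Sx A).filter Dg1).card + ((Sx A).filter Dg2).card + ((Sx A).filter Dg3).card + ((Sx A).filter Dg4).card + ((Sx A).filter Dg5).card + ((Sx A).filter (QLo A (α * N ^ 2))).card + ((Sx A).filter (QHi A (α * N ^ 2))).card := by
        refine (Finset.card_le_card hsub).trans ?_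
        refine (Finset.card_union_le _ _).trans (Nat.add_le_add_right ?_ _)
        refine (Finset.card_union_le _ _).trans (Nat.add_le_add_right ?_ _)
        refine (Finset.card_union_le _ _).trans (Nat.add_le_add_right ?_ _)
        refine (Finset.card_union_le _ _).trans (Nat.add_le_add_right ?_ _)
        refine (Finset.card_union_le _ _).trans (Nat.add_le_add_right ?_ _)
        exact Finset.card_union_le _ _
      have k2 : collinearTriples A A ≤ 5 * A.card ^ 4 + ((Sx A).filter (QLo A (α * N ^ 2))).card + ((Sx A).filter (QHi A (α * N ^ 2))).card := by omega
      have k3 : (collinearTriples A A : ℝ) ≤ 5 * N ^ 4 + ((Sx A).filter (QLo A (α * N ^ 2))).card + ((Sx A).filter (QHi A (α * N ^ 2))).card := by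
        have k2c : (collinearTriples A A : ℝ) ≤ 5 * (A.card : ℝ) ^ 4 +
            ((Sx A).filter (QLo A (α * N ^ 2))).card +
            ((Sx A).filter (QHi A (α * N ^ 2))).card := by exact_mod_cast k2
        rw [← hNd] at k2c
        exact k2c
      linarith
    have h4 : 6 * N ^ 4 ≤ (α * N) * N ^ 4 := by gcongr
    have h5 : (α * N) * N ^ 4 = α * N ^ 5 := by ring
    have h6 : 0 < N ^ 4 := by positivity
    nlinarith


lemma prop_main [Finite F] (A : Finset F) (α β : ℝ) (hα : 0 < α) (hβ : β = α / 2048)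
    (hA : 0 < A.card) (hN : 6 ≤ α * A.card)
    (hT : 8 * α * (A.card : ℝ) ^ 5 ≤ (collinearTriples A A : ℝ)) :
    α ≤ 1 ∧ (2 < β ^ 91 * (A.card : ℝ) → ∃ (G : Subfield F) (c d : F),
      β ^ 2 * (A.card : ℝ) ≤ ((A.filter fun x => ∃ g ∈ G, x = c * g + d).card : ℝ) ∧
      β ^ 63 * (Nat.card G : ℝ) ≤ 3 * A.card) := by
  obtain ⟨I, a, δ, hδ, hI0, hI1, hI, hIA, hb⟩ := T_setup A α hα hA hN hT
  have hinj : Function.Injective (fun b : F => δ * b + a) := by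
    intro x y hxy
    exact mul_left_cancel₀ hδ (add_right_cancel hxy)
  have hcard : (0 : ℝ) < A.card := by exact_mod_cast hA
  have hα1 : α ≤ 1 := by
    have h1 : I.card ≤ A.card :=
      Finset.card_le_card_of_injOn (fun b => δ * b + a)
        (fun b hb => Finset.mem_coe.2 (hIA b (Finset.mem_coe.1 hb))) hinj.injOn
    have h2 : (I.card : ℝ) ≤ A.card := by exact_mod_cast h1
    have h3 : α * A.card ≤ 1 * A.card := by linarith
    exact le_of_mul_le_mul_right h3 hcard
  refine ⟨hα1, fun hN2 => ?_⟩
  obtain ⟨X, Z, B, Q0, ξ, ζ, hConf, hBI, hBc, hQB, hQc, hξ, hQ⟩ :=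
    lemma3 I A α β hα hα1 hβ hA hI0 hI1 hI hb
  have hβ0 : 0 < β := by rw [hβ]; positivity
  have hBne : B.Nonempty := by
    rw [← Finset.card_pos]
    have : (0 : ℝ) < B.card := lt_of_lt_of_le (by positivity) hBc
    exact_mod_cast this
  obtain ⟨b0, hb0⟩ := hBne
  obtain ⟨G, hG, hGc⟩ := hConf.propG Q0 hQB hQc ξ ζ hξ hQ hN2 b0 hb0
  refine ⟨G, δ * b0, a, hBc.trans ?_, hGc⟩
  have : B.card ≤ (A.filter fun x => ∃ g ∈ G, x = δ * b0 * g + a).card := by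
    apply Finset.card_le_card_of_injOn (fun b => δ * b + a) _ hinj.injOn
    intro b hb
    have hb := Finset.mem_coe.1 hb
    obtain ⟨g, hg, hbg⟩ := hG b hb
    refine Finset.mem_coe.2 (Finset.mem_filter.2 ⟨hIA b (hBI hb), g, hg, ?_⟩)
    simp only
    rw [hbg]; ring
  exact_mod_cast this

lemma rpow_aux1 (N β K : ℝ) (hN : 0 < N) (hK : 0 ≤ K) 
    (h : K * N ^ (-(1:ℝ) / 104) ≤ β) : K ^ 104 ≤ β ^ 104 * N ∧ K ^ 2 * N ^ ((51:ℝ)/52) ≤ β ^ 2 * N := by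
  have h0 : 0 ≤ K * N ^ (-(1:ℝ) / 104) := by positivity
  constructor
  · have h1 := pow_le_pow_left₀ h0 h 104
    have h2 : (N ^ (-(1:ℝ) / 104)) ^ 104 * N = 1 := by
      rw [← Real.rpow_natCast, ← Real.rpow_mul hN.le]
      norm_num
      rw [Real.rpow_neg_one]
      field_simp
    calc K ^ 104 = K ^ 104 * ((N ^ (-(1:ℝ) / 104)) ^ 104 * N) := by rw [h2, mul_one]
      _ = (K * N ^ (-(1:ℝ) / 104)) ^ 104 * N := by rw [mul_pow]; ring
      _ ≤ _ := by gcongr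
  · have h1 := pow_le_pow_left₀ h0 h 2
    have h2 : (N ^ (-(1:ℝ) / 104)) ^ 2 * N = N ^ ((51:ℝ)/52) := by
      rw [← Real.rpow_natCast, ← Real.rpow_mul hN.le]
      nth_rewrite 2 [← Real.rpow_one N]
      rw [← Real.rpow_add hN]
      norm_num
    calc K ^ 2 * N ^ ((51:ℝ)/52) = (K * N ^ (-(1:ℝ) / 104)) ^ 2 * N := by rw [mul_pow, ← h2]; ring
      _ ≤ _ := by gcongr

lemma rpow_aux2 (N q β K : ℝ) (hN : 0 < N) (hq : 0 < q) (hK : 0 ≤ K)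
    (h : K * (q ^ (-(1:ℝ) / 95) * N ^ ((1:ℝ) / 95)) ≤ β) : K ^ 95 * N ≤ β ^ 95 * q := by
  have h0 : 0 ≤ K * (q ^ (-(1:ℝ) / 95) * N ^ ((1:ℝ) / 95)) := by positivity
  have h1 := pow_le_pow_left₀ h0 h 95
  have h2 : (q ^ (-(1:ℝ) / 95)) ^ 95 * q = 1 := by
    rw [← Real.rpow_natCast, ← Real.rpow_mul hq.le]
    norm_num
    rw [Real.rpow_neg_one]
    field_simp
  have h3 : (N ^ ((1:ℝ) / 95)) ^ 95 = N := by
    rw [← Real.rpow_natCast, ← Real.rpow_mul hN.le]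
    norm_num
  calc K ^ 95 * N = K ^ 95 * (N ^ ((1:ℝ) / 95)) ^ 95 * ((q ^ (-(1:ℝ) / 95)) ^ 95 * q) := by
        rw [h2, h3, mul_one]
    _ = (K * (q ^ (-(1:ℝ) / 95) * N ^ ((1:ℝ) / 95))) ^ 95 * q := by rw [mul_pow, mul_pow]; ring
    _ ≤ _ := by gcongr


lemma num_K (C K : ℝ) (hC : 0 < C) (hKd : K = 2 + C) : 4 * K ^ 2 ≤ K ^ 4 ∧ 2 * K ≤ K ^ 2 ∧
    C ^ 2 < K ^ 2 ∧ 4 ≤ K ^ 2 := by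
  have hK2 : 2 ≤ K := by linarith
  have h4 : 4 ≤ K ^ 2 := by nlinarith
  refine ⟨?_, by nlinarith, by rw [hKd]; nlinarith, h4⟩
  calc 4 * K ^ 2 ≤ K ^ 2 * K ^ 2 := by gcongr
    _ = K ^ 4 := by ring


set_option maxHeartbeats 1000000 in
theorem stmt3 : ∀ C : ℝ, 0 < C → ∃ C' : ℝ, 0 < C' ∧
    ∀ (F : Type) [Field F] [Fintype F] (q : ℕ), IsPrimePow q → Fintype.card F = q →
    ∀ A : Finset F, 2 ≤ A.card →
    subfieldCond A C ((A.card : ℝ) ^ ((51:ℝ)/52)) →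
    (collinearTriples A A : ℝ) ≤
      C' * ((A.card : ℝ) ^ ((5:ℝ) - 1/104)
        + (q : ℝ) ^ (-(1:ℝ)/95) * (A.card : ℝ) ^ ((5:ℝ) + 1/95)) := by
  intro C hC
  obtain ⟨K, hKd⟩ : ∃ K : ℝ, K = 2 + C := ⟨_, rfl⟩
  have hK2 : 2 ≤ K := by linarith
  have hK0 : 0 < K := by linarith
  refine ⟨8 * (2048 * K), by positivity, ?_⟩
  intro F _ _ q hqp hFq A hA2 hsub
  by_contra hcon
  have hcon := not_le.1 hcon
  have hA0 : 0 < A.card := by omega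
  obtain ⟨N, hNd⟩ : ∃ N : ℝ, N = (A.card : ℝ) := ⟨_, rfl⟩
  have hN2 : 2 ≤ N := by rw [hNd]; exact_mod_cast hA2
  have hN0 : 0 < N := by linarith
  have hq0 : (0 : ℝ) < q := by exact_mod_cast hqp.pos
  obtain ⟨T, hTd⟩ : ∃ T : ℝ, T = (collinearTriples A A : ℝ) := ⟨_, rfl⟩
  rw [← hTd, ← hNd] at hcon
  obtain ⟨α, hαd⟩ : ∃ α : ℝ, α = T / (8 * N ^ 5) := ⟨_, rfl⟩
  have hTα : T = 8 * α * N ^ 5 := by rw [hαd]; field_simp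
  have s1 : N ^ ((5:ℝ) - 1 / 104) = N ^ 5 * N ^ (-(1:ℝ) / 104) := by
    rw [← Real.rpow_natCast, ← Real.rpow_add hN0]; norm_num
  have s2 : N ^ ((5:ℝ) + 1 / 95) = N ^ 5 * N ^ ((1:ℝ) / 95) := by
    rw [← Real.rpow_natCast, ← Real.rpow_add hN0]; norm_num
  obtain ⟨u, hu⟩ : ∃ u : ℝ, u = N ^ (-(1:ℝ) / 104) := ⟨_, rfl⟩
  obtain ⟨v, hv⟩ : ∃ v : ℝ, v = (q : ℝ) ^ (-(1:ℝ) / 95) * N ^ ((1:ℝ) / 95) := ⟨_, rfl⟩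
  have hu0 : 0 < u := by rw [hu]; positivity
  have hv0 : 0 < v := by rw [hv]; positivity
  have hα1 : 2048 * K * (u + v) < α := by
    have h5 : 0 < 8 * N ^ 5 := by positivity
    have e : 8 * (2048 * K) * (N ^ ((5:ℝ) - 1 / 104) +
        (q : ℝ) ^ (-(1:ℝ) / 95) * N ^ ((5:ℝ) + 1 / 95)) = 2048 * K * (u + v) * (8 * N ^ 5) := by
      rw [s1, s2, hu, hv]; ring
    rw [e, hTα] at hcon
    refine lt_of_mul_lt_mul_right ?_ h5.le
    linarith
  obtain ⟨β, hβ⟩ : ∃ β : ℝ, β = α / 2048 := ⟨_, rfl⟩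
  have hβuv : K * (u + v) < β := by rw [hβ]; linarith
  have hKu : 0 < K * u := by positivity
  have hKv : 0 < K * v := by positivity
  have hβu : K * u ≤ β := by linarith
  have hβv : K * v ≤ β := by linarith
  have hβ0 : 0 < β := by linarith
  have hα0 : 0 < α := by rw [hβ] at hβ0; linarith
  rw [hu] at hβu
  rw [hv] at hβv
  obtain ⟨r1, r2⟩ := rpow_aux1 N β K hN0 hK0.le hβu
  have r3 := rpow_aux2 N q β K hN0 hq0 hK0.le hβv
  have hN6 : 6 ≤ α * N := by
    have h1 : 1 ≤ N ^ (-(1:ℝ) / 104) * N := by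
      nth_rewrite 2 [← Real.rpow_one N]
      rw [← Real.rpow_add hN0]
      exact Real.one_le_rpow (by linarith) (by norm_num)
    have h2 : K * (N ^ (-(1:ℝ) / 104) * N) ≤ β * N := by
      rw [← mul_assoc]; gcongr
    have h3 : K * 1 ≤ K * (N ^ (-(1:ℝ) / 104) * N) := by gcongr
    have h4 : α * N = 2048 * (β * N) := by rw [hβ]; ring
    linarith
  have hpm := prop_main A α β hα0 hβ hA0 (by rw [← hNd]; exact hN6)
    (by rw [← hNd, ← hTd]; exact hTα.ge)
  rw [← hNd] at hpm
  obtain ⟨hαle, hpm⟩ := hpm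
  have hβ1 : β ≤ 1 := by rw [hβ]; linarith
  have hK1 : 1 ≤ K := by linarith
  have k4 : K ^ 4 ≤ K ^ 104 := pow_le_pow_right₀ hK1 (by norm_num)
  obtain ⟨k44, k2, kC, kk4⟩ := num_K C K hC hKd
  have p91 : β ^ 104 * N ≤ β ^ 91 * N :=
    mul_le_mul_of_nonneg_right (pow_le_pow_of_le_one hβ0.le hβ1 (by norm_num)) hN0.le
  have p67 : β ^ 104 * N ≤ β ^ 67 * N :=
    mul_le_mul_of_nonneg_right (pow_le_pow_of_le_one hβ0.le hβ1 (by norm_num)) hN0.le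
  have p63 : β ^ 95 * (q : ℝ) ≤ β ^ 63 * q :=
    mul_le_mul_of_nonneg_right (pow_le_pow_of_le_one hβ0.le hβ1 (by norm_num)) hq0.le
  obtain ⟨G, c, d, hGA, hGc⟩ := hpm (by linarith)
  have hGtop : G ≠ ⊤ := by
    intro hG
    have h1 : Nat.card G = q := by
      rw [hG, ← hFq, ← Nat.card_eq_fintype_card]
      exact Nat.card_congr (Equiv.Set.univ F)
    rw [h1] at hGc
    have h2 : K ^ 2 ≤ K ^ 95 := pow_le_pow_right₀ hK1 (by norm_num)
    have h2' : 4 ≤ K ^ 95 := kk4.trans h2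
    have h3 : 4 * N ≤ K ^ 95 * N := mul_le_mul_of_nonneg_right h2' hN0.le
    linarith
  have hs := hGA.trans (hsub G hGtop c d)
  rw [← hNd] at hs
  rcases max_cases ((Nat.card G : ℝ) ^ ((1:ℝ) / 2)) (N ^ ((51:ℝ) / 52)) with ⟨hm, _⟩ | ⟨hm, _⟩
  · rw [hm] at hs
    have h1 := pow_le_pow_left₀ (by positivity) hs 2
    have h2 : ((Nat.card G : ℝ) ^ ((1:ℝ) / 2)) ^ 2 = Nat.card G := by
      rw [← Real.rpow_natCast, ← Real.rpow_mul (by positivity)]; norm_num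
    rw [mul_pow C, h2] at h1
    have h3 : β ^ 67 * N * N ≤ 3 * C ^ 2 * N := by
      calc β ^ 67 * N * N = β ^ 63 * (β ^ 2 * N) ^ 2 := by ring
        _ ≤ β ^ 63 * (C ^ 2 * Nat.card G) := by gcongr
        _ = C ^ 2 * (β ^ 63 * Nat.card G) := by ring
        _ ≤ C ^ 2 * (3 * N) := by gcongr
        _ = _ := by ring
    have h4 := le_of_mul_le_mul_right h3 hN0
    linarith
  · rw [hm] at hs
    have h1 : K ^ 2 * N ^ ((51:ℝ) / 52) ≤ C * N ^ ((51:ℝ) / 52) := r2.trans hs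
    have h2 := le_of_mul_le_mul_right h1 (by positivity)
    linarith

end STP
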